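/- Let $F$ be a field with $\operatorname{char}F\neq 2,3$ and let $(\alpha,\beta)=(2,\tfrac12)$. Let $V$ be a commutative, not necessarily associative or unital, $F$-algebra. For $a\in V$ and $\mu\in F$ put $V_\mu^a=\{x\in V: ax=\mu x\}$. An idempotent $a\in V$ is a *primitive axis of Monster type $(\alpha,\beta)$* if $V=V_1^a\oplus V_0^a\oplus V_\alpha^a\oplus V_\beta^a$, $V_1^a=Fa$, and $V_1^aV_0^a=0$, $V_1^aV_\alpha^a\subseteq V_\alpha^a$, $V_1^aV_\beta^a\subseteq V_\beta^a$, $V_0^aV_0^a\subseteq V_0^a$, $V_0^aV_\alpha^a\subseteq V_\alpha^a$, $V_0^aV_\beta^a\subseteq V_\beta^a$, $V_\alpha^aV_\alpha^a\subseteq V_1^a+V_0^a$, $V_\alpha^aV_\beta^a\subseteq V_\beta^a$, $V_\beta^aV_\beta^a\subseteq V_1^a+V_0^a+V_\alpha^a$. For such $a$, let $\tau_a$ be the linear map that is the identity on $V_1^a+V_0^a+V_\alpha^a$ and $-1$ on $V_\beta^a$ (an algebra automorphism), and let $\lambda_a(x)\in F$ be the coefficient of $a$ in the decomposition $x=\lambda_a(x)a+x_0+x_\alpha+x_\beta$,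 $x_\mu\in V_\mu^a$. Let $V$ be generated as an $F$-algebra by two primitive axes $a_0,a_1$ of Monster type $(2,\tfrac12)$. Let $\rho=\tau_{a_0}\tau_{a_1}$ (maps act on the right), and for $i\in\mathbb Z$ put $a_{2i}=a_0^{\rho^i}$, $a_{2i+1}=a_1^{\rho^i}$, $\lambda_i=\lambda_{a_0}(a_i)$, $\lambda_i^f=\lambda_{a_1}(a_{1-i})$. For $r\in\mathbb Z$ and $n\ge 0$ put $s_{r,n}=a_ra_{r+n}-\tfrac12(a_r+a_{r+n})$. Define $\delta:\mathbb Z\to F$ by $\delta(m)=0$ for all $m$ if $\operatorname{char}F\ne5$, and, if $\operatorname{char}F=5$, by $\delta(m)=0,1,-1$ according as $m\equiv0,1,2\pmod 3$. Assume $\lambda_1=\lambda_1^f=\lambda_2=\lambda_2^f=1$. Then for all integers $i\ge1$, all integers $j$ with $1\le j<i$, and all $r,t,l\in\mathbb Z$: 1. $\lambda_i=\lambda_i^f=1$; 2. if $\operatorname{char}F\ne5$, or if $\operatorname{char}F=5$ and $i\not\equiv0\pmod3$, then $s_{r,i}=s_{0,i}$; 3. if $\operatorname{char}F=5$, $i\equiv0\pmod3$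 and $t\equiv r\pmod3$, then $s_{r,i}=s_{t,i}$; 4. $\lambda_{a_0}(s_{r,i})=0$; 5. $a_l\,s_{r,i}=-\tfrac34a_l+\tfrac38(a_{l-i}+a_{l+i})+\tfrac32s_{r,i}+\delta(l-r)\,(s_{r-1,i}-s_{r+1,i})$; 6. $s_{r,j}\,s_{r,i-j}=\tfrac34(s_{r,j}+s_{r,i-j})-\tfrac34s_{r,|i-2j|}+\tfrac3{16}(s_{r+j,|i-2j|}+s_{r-j,|i-2j|})-\tfrac34s_{r,i}+\tfrac3{16}(s_{r+j,i}+s_{r-j,i})$; in particular, if $\operatorname{char}F\neq5$, or $3\nmid i-2j$, or $i=2j$ with $3\nmid j$, then $s_{r,j}\,s_{r,i-j}=\tfrac34(s_{r,j}+s_{r,i-j})-\tfrac38s_{r,|i-2j|}-\tfrac34s_{r,i}+\tfrac3{16}(s_{r+1,i}+s_{r+2,i})$. -/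

import Mathlib

namespace AxialFormal

universe u v

section

variable (F : Type u) [Field F] {V : Type v} [NonUnitalNonAssocCommRing V]
  [Module F V] [SMulCommClass F V V] [IsScalarTower F V V]

/-- The `μ`-eigenspace `V_μ^a` of the adjoint map `ad_a : x ↦ a * x`. -/
def eigSp (a : V) (μ : F) : Submodule F V where
  carrier := {w | a * w = μ • w}
  add_mem' := by
    intro x y hx hy
    simp only [Set.mem_ofPred_eq] at hx hy ⊢
    rw [mul_add, hx, hy, smul_add]
  zero_mem' := by
    simp only [Set.mem_ofPred_eq, mul_zero, smul_zero]
  smul_mem' := by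
    intro c x hx
    simp only [Set.mem_ofPred_eq] at hx ⊢
    rw [mul_smul_comm, hx, smul_comm]

/-- `a` is a primitive axis of Monster type `(α, β)` in the commutative
(not necessarily associative or unital) `F`-algebra `V`. The sum in `decomp` is
direct as soon as `1, 0, α, β` are distinct, eigenspaces being independent. -/
structure IsAxis (α β : F) (a : V) : Prop where
  idem : a * a = a
  primitive : eigSp F a 1 = Submodule.span F {a}
  decomp : eigSp F a 1 ⊔ eigSp F a 0 ⊔ eigSp F a α ⊔ eigSp F a β = ⊤
  fusion_one_zero : ∀ u ∈ eigSp F a 1, ∀ w ∈ eigSp F a 0, u * w = 0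
  fusion_one_alpha : ∀ u ∈ eigSp F a 1, ∀ w ∈ eigSp F a α, u * w ∈ eigSp F a α
  fusion_one_beta : ∀ u ∈ eigSp F a 1, ∀ w ∈ eigSp F a β, u * w ∈ eigSp F a β
  fusion_zero_zero : ∀ u ∈ eigSp F a 0, ∀ w ∈ eigSp F a 0, u * w ∈ eigSp F a 0
  fusion_zero_alpha : ∀ u ∈ eigSp F a 0, ∀ w ∈ eigSp F a α, u * w ∈ eigSp F a α
  fusion_zero_beta : ∀ u ∈ eigSp F a 0, ∀ w ∈ eigSp F a β, u * w ∈ eigSp F a β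
  fusion_alpha_alpha : ∀ u ∈ eigSp F a α, ∀ w ∈ eigSp F a α,
    u * w ∈ eigSp F a 1 ⊔ eigSp F a 0
  fusion_alpha_beta : ∀ u ∈ eigSp F a α, ∀ w ∈ eigSp F a β, u * w ∈ eigSp F a β
  fusion_beta_beta : ∀ u ∈ eigSp F a β, ∀ w ∈ eigSp F a β,
    u * w ∈ eigSp F a 1 ⊔ eigSp F a 0 ⊔ eigSp F a α

/-- `(V, {a₀, a₁})` is a primitive 2-generated axial algebra of Monster type `(α, β)`. -/
structure IsTwoGenerated (α β : F) (a₀ a₁ : V) : Prop where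
  axis₀ : IsAxis F α β a₀
  axis₁ : IsAxis F α β a₁
  generates : NonUnitalAlgebra.adjoin F {a₀, a₁} = ⊤

/-- The even part `V₊ᵃ = V₁ᵃ + V₀ᵃ + V_αᵃ`. -/
def plusPart (α : F) (a : V) : Submodule F V :=
  eigSp F a 1 ⊔ eigSp F a 0 ⊔ eigSp F a α

open scoped Classical in
/-- The Miyamoto map `τ_a` : the linear map which is the identity on
`V₊ᵃ = V₁ᵃ + V₀ᵃ + V_αᵃ` and minus the identity on `V_βᵃ`, i.e. `x ↦ x - 2 x_β`
where `x_β` is the component of `x` in `V_βᵃ` along `V₊ᵃ`. (If `V` is not the direct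
sum of these two subspaces, which does not happen for an axis, it is set to `1`.) -/
noncomputable def miyamoto (α β : F) (a : V) : V ≃ₗ[F] V :=
  if hc : IsCompl (eigSp F a β) (plusPart F α a) then
    LinearEquiv.ofInvolutive
      (LinearMap.id - (2 : F) • Submodule.projection _ _ hc) (by
        intro x
        have h : Submodule.projection _ _ hc (Submodule.projection _ _ hc x)
            = Submodule.projection _ _ hc x :=
          Submodule.projection_apply_left hc
            ⟨_, Submodule.projection_apply_mem hc x⟩
        simp only [LinearMap.sub_apply, LinearMap.id_apply, LinearMap.smul_apply,
          map_sub, map_smul, h]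
        module)
  else 1

variable {F}

theorem IsAxis.isCompl {α β : F} (h0 : β ≠ 0) (h1 : β ≠ 1) (hα : β ≠ α) {a : V}
    (h : IsAxis F α β a) : IsCompl (eigSp F a β) (plusPart F α a) := by
  have key : ∀ μ : F, eigSp F a μ = Module.End.eigenspace (LinearMap.mulLeft F a) μ := by
    intro μ
    ext x
    rw [Module.End.mem_eigenspace_iff]
    rfl
  constructor
  · have hd := (Module.End.eigenspaces_iSupIndep (LinearMap.mulLeft F a)).disjoint_biSup
      (x := β) (y := ({1, 0, α} : Set F)) (by simp [h0, h1, hα])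
    rw [key, plusPart, key, key, key]
    refine hd.mono_right ?_
    refine sup_le (sup_le ?_ ?_) ?_
    · exact le_biSup (fun μ => Module.End.eigenspace (LinearMap.mulLeft F a) μ)
        (show (1 : F) ∈ ({1, 0, α} : Set F) by simp)
    · exact le_biSup (fun μ => Module.End.eigenspace (LinearMap.mulLeft F a) μ)
        (show (0 : F) ∈ ({1, 0, α} : Set F) by simp)
    · exact le_biSup (fun μ => Module.End.eigenspace (LinearMap.mulLeft F a) μ)
        (show α ∈ ({1, 0, α} : Set F) by simp)
  · rw [codisjoint_iff, sup_comm]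
    exact h.decomp

/-- The Miyamoto map of an axis fixes `V₊ᵃ` pointwise. -/
theorem miyamoto_of_mem_plus {α β : F} (h0 : β ≠ 0) (h1 : β ≠ 1) (hα : β ≠ α) {a : V}
    (h : IsAxis F α β a) {x : V} (hx : x ∈ plusPart F α a) : miyamoto F α β a x = x := by
  have hp : Submodule.projection _ _ (h.isCompl h0 h1 hα) x = 0 :=
    (Submodule.projection_apply_eq_zero_iff _).2 hx
  rw [miyamoto, dif_pos (h.isCompl h0 h1 hα)]
  change x - (2 : F) • Submodule.projection _ _ (h.isCompl h0 h1 hα) x = x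
  rw [hp, smul_zero, sub_zero]

/-- The Miyamoto map of an axis negates `V_βᵃ`. -/
theorem miyamoto_of_mem_minus {α β : F} (h0 : β ≠ 0) (h1 : β ≠ 1) (hα : β ≠ α) {a : V}
    (h : IsAxis F α β a) {x : V} (hx : x ∈ eigSp F a β) : miyamoto F α β a x = -x := by
  have hp : Submodule.projection _ _ (h.isCompl h0 h1 hα) x = x :=
    Submodule.projection_apply_left (h.isCompl h0 h1 hα) ⟨x, hx⟩
  rw [miyamoto, dif_pos (h.isCompl h0 h1 hα)]
  change x - (2 : F) • Submodule.projection _ _ (h.isCompl h0 h1 hα) x = -x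
  rw [hp]
  module

variable (F)

/-- The bi-infinite sequence of axes `a_j`, with `a_{2i} = a₀^{ρ^i}` and
`a_{2i+1} = a₁^{ρ^i}` where `ρ = τ₀τ₁`, maps acting on the right: `x^ρ = τ₁ (τ₀ x)`. -/
noncomputable def axSeq (α β : F) (a₀ a₁ : V) (j : ℤ) : V :=
  ((miyamoto F α β a₁ * miyamoto F α β a₀) ^ (j / 2)) (if j % 2 = 0 then a₀ else a₁)

/-- `s_{r,n} = a_r a_{r+n} - β (a_r + a_{r+n})`. -/
noncomputable def sElt (α β : F) (a₀ a₁ : V) (r n : ℤ) : V :=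
  axSeq F α β a₀ a₁ r * axSeq F α β a₀ a₁ (r + n)
    - β • (axSeq F α β a₀ a₁ r + axSeq F α β a₀ a₁ (r + n))

/-- `λ_a(x) = l`, where `λ_a(x)` is the projection of `x` onto the primitive axis `a`:
`x = l • a + x₀ + x_α + x_β` with `x_μ ∈ V_μ^a`. -/
def HasProj (α β : F) (a x : V) (l : F) : Prop :=
  ∃ v₀ ∈ eigSp F a 0, ∃ vα ∈ eigSp F a α, ∃ vβ ∈ eigSp F a β,
    x = l • a + v₀ + vα + vβ

open scoped Classical in
/-- `δ : ℤ → F`: identically `0` if `char F ≠ 5`; if `char F = 5`, it is `0, 1, -1`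
according as the argument is `0, 1, 2 (mod 3)`. -/
noncomputable def charDelta (m : ℤ) : F :=
  if (5 : F) = 0 then
    (if m % 3 = 0 then 0 else if m % 3 = 1 then 1 else -1)
  else 0

end

end AxialFormal

set_option linter.unusedSectionVars false

namespace AxialFormal

section

variable {F : Type*} [Field F] {V : Type*} [NonUnitalNonAssocCommRing V]
  [Module F V] [SMulCommClass F V V] [IsScalarTower F V V]

theorem mem_plusPart {α : F} {a x : V} : x ∈ plusPart F α a ↔
    ∃ u ∈ eigSp F a 1, ∃ v ∈ eigSp F a 0, ∃ w ∈ eigSp F a α, x = u + v + w := by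
  simp only [plusPart, Submodule.mem_sup]
  constructor
  · rintro ⟨_, ⟨u, hu, v, hv, rfl⟩, w, hw, rfl⟩
    exact ⟨u, hu, v, hv, w, hw, rfl⟩
  · rintro ⟨u, hu, v, hv, w, hw, rfl⟩
    exact ⟨_, ⟨u, hu, v, hv, rfl⟩, w, hw, rfl⟩

theorem IsAxis.mul_mem_plusPart {α β : F} {a : V} (h : IsAxis F α β a) {x y : V}
    (hx : x ∈ plusPart F α a) (hy : y ∈ plusPart F α a) : x * y ∈ plusPart F α a := by
  have i1 : eigSp F a 1 ≤ plusPart F α a := le_sup_left.trans le_sup_left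
  have i0 : eigSp F a 0 ≤ plusPart F α a := le_sup_right.trans le_sup_left
  have iα : eigSp F a α ≤ plusPart F α a := le_sup_right
  have i10 : eigSp F a 1 ⊔ eigSp F a 0 ≤ plusPart F α a := le_sup_left
  obtain ⟨u, hu, v, hv, w, hw, rfl⟩ := mem_plusPart.1 hx
  obtain ⟨u', hu', v', hv', w', hw', rfl⟩ := mem_plusPart.1 hy
  have huu : u * u' ∈ eigSp F a 1 := by
    rw [h.primitive] at hu
    obtain ⟨c, rfl⟩ := Submodule.mem_span_singleton.1 hu
    have hu' : a * u' = (1 : F) • u' := hu'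
    rw [smul_mul_assoc, hu', one_smul]
    exact Submodule.smul_mem _ _ ‹u' ∈ eigSp F a 1›
  simp only [add_mul, mul_add]
  rw [h.fusion_one_zero u hu v' hv', mul_comm v u', h.fusion_one_zero u' hu' v hv,
    mul_comm w u', mul_comm w v']
  have k1 := i1 huu
  have k2 := iα (h.fusion_one_alpha u hu w' hw')
  have k3 := iα (h.fusion_one_alpha u' hu' w hw)
  have k4 := i0 (h.fusion_zero_zero v hv v' hv')
  have k5 := iα (h.fusion_zero_alpha v hv w' hw')
  have k6 := iα (h.fusion_zero_alpha v' hv' w hw)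
  have k7 := i10 (h.fusion_alpha_alpha w hw w' hw')
  have k0 := (plusPart F α a).zero_mem
  repeat' apply Submodule.add_mem
  all_goals assumption

theorem IsAxis.plusPart_mul_mem {α β : F} {a : V} (h : IsAxis F α β a) {x y : V}
    (hx : x ∈ plusPart F α a) (hy : y ∈ eigSp F a β) : x * y ∈ eigSp F a β := by
  obtain ⟨u, hu, v, hv, w, hw, rfl⟩ := mem_plusPart.1 hx
  simp only [add_mul]
  exact add_mem (add_mem (h.fusion_one_beta u hu y hy) (h.fusion_zero_beta v hv y hy))
    (h.fusion_alpha_beta w hw y hy)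

theorem IsAxis.miyamoto_mul {α β : F} (h0 : β ≠ 0) (h1 : β ≠ 1) (hα : β ≠ α) {a : V}
    (h : IsAxis F α β a) (x y : V) :
    miyamoto F α β a (x * y) = miyamoto F α β a x * miyamoto F α β a y := by
  have htop := codisjoint_iff.1 (h.isCompl h0 h1 hα).codisjoint
  have hdec : ∀ x : V, ∃ m ∈ eigSp F a β, ∃ p ∈ plusPart F α a, m + p = x := fun x =>
    Submodule.mem_sup.1 (htop ▸ Submodule.mem_top)
  obtain ⟨m, hm, p, hp, rfl⟩ := hdec x
  obtain ⟨n, hn, q, hq, rfl⟩ := hdec y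
  have e1 := miyamoto_of_mem_plus h0 h1 hα h (h.fusion_beta_beta m hm n hn)
  have e2 := miyamoto_of_mem_plus h0 h1 hα h (h.mul_mem_plusPart hp hq)
  have e3 := miyamoto_of_mem_minus h0 h1 hα h (h.plusPart_mul_mem hp hn)
  have e4 := miyamoto_of_mem_minus h0 h1 hα h (h.plusPart_mul_mem hq hm)
  rw [mul_comm q m] at e4
  simp only [add_mul, mul_add, map_add, e1, e2, e3, e4, miyamoto_of_mem_plus h0 h1 hα h hp,
    miyamoto_of_mem_plus h0 h1 hα h hq, miyamoto_of_mem_minus h0 h1 hα h hm,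
    miyamoto_of_mem_minus h0 h1 hα h hn, neg_mul, mul_neg]
  abel

theorem IsAxis.miyamoto_miyamoto {α β : F} (h0 : β ≠ 0) (h1 : β ≠ 1) (hα : β ≠ α) {a : V}
    (h : IsAxis F α β a) (x : V) : miyamoto F α β a (miyamoto F α β a x) = x := by
  obtain ⟨m, hm, p, hp, rfl⟩ : ∃ m ∈ eigSp F a β, ∃ p ∈ plusPart F α a, m + p = x :=
    Submodule.mem_sup.1 (codisjoint_iff.1 (h.isCompl h0 h1 hα).codisjoint ▸ Submodule.mem_top)
  simp only [map_add, map_neg, miyamoto_of_mem_plus h0 h1 hα h hp,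
    miyamoto_of_mem_minus h0 h1 hα h hm, neg_neg]

theorem IsAxis.self_mem_eigSp {α β : F} {a : V} (h : IsAxis F α β a) : a ∈ eigSp F a 1 := by
  rw [h.primitive]
  exact Submodule.mem_span_singleton_self a

theorem IsAxis.self_mem_plusPart {α β : F} {a : V} (h : IsAxis F α β a) : a ∈ plusPart F α a :=
  (le_sup_left.trans le_sup_left : eigSp F a 1 ≤ plusPart F α a) h.self_mem_eigSp

theorem map_eigSp (g : V ≃ₗ[F] V) (hg : ∀ x y, g (x * y) = g x * g y) (a : V) (μ : F) :
    (eigSp F a μ).map (g : V →ₗ[F] V) = eigSp F (g a) μ := by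
  ext x
  rw [Submodule.mem_map]
  constructor
  · rintro ⟨y, hy, rfl⟩
    have hy : a * y = μ • y := hy
    change g a * g y = μ • g y
    rw [← hg, hy, map_smul]
  · intro hx
    have hx : g a * x = μ • x := hx
    refine ⟨g.symm x, ?_, g.apply_symm_apply x⟩
    change a * g.symm x = μ • g.symm x
    apply g.injective
    rw [hg, map_smul, g.apply_symm_apply, hx]

theorem IsAxis.map {α β : F} {a : V} (h : IsAxis F α β a) (g : V ≃ₗ[F] V)
    (hg : ∀ x y, g (x * y) = g x * g y) : IsAxis F α β (g a) := by
  have key : ∀ {A B C : Submodule F V}, (∀ u ∈ A, ∀ w ∈ B, u * w ∈ C) →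
      ∀ u ∈ A.map (g : V →ₗ[F] V), ∀ w ∈ B.map (g : V →ₗ[F] V),
        u * w ∈ C.map (g : V →ₗ[F] V) := by
    rintro A B C hABC _ ⟨u, hu, rfl⟩ _ ⟨w, hw, rfl⟩
    exact ⟨u * w, hABC u hu w hw, hg u w⟩
  constructor
  · rw [← hg, h.idem]
  · rw [← map_eigSp g hg, h.primitive, Submodule.map_span, Set.image_singleton]
    rfl
  · simp only [← map_eigSp g hg, ← Submodule.map_sup, h.decomp]
    rw [Submodule.map_top, LinearEquiv.range]
  · simp only [← map_eigSp g hg]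
    rintro _ ⟨u, hu, rfl⟩ _ ⟨w, hw, rfl⟩
    exact (hg u w).symm.trans (by rw [h.fusion_one_zero u hu w hw, map_zero])
  all_goals simp only [← map_eigSp g hg, ← Submodule.map_sup]
  · exact key h.fusion_one_alpha
  · exact key h.fusion_one_beta
  · exact key h.fusion_zero_zero
  · exact key h.fusion_zero_alpha
  · exact key h.fusion_zero_beta
  · exact key h.fusion_alpha_alpha
  · exact key h.fusion_alpha_beta
  · exact key h.fusion_beta_beta

theorem HasProj.map {α β : F} {a x : V} {l : F} (h : HasProj F α β a x l) (g : V ≃ₗ[F] V)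
    (hg : ∀ x y, g (x * y) = g x * g y) : HasProj F α β (g a) (g x) l := by
  obtain ⟨u, hu, v, hv, w, hw, rfl⟩ := h
  refine ⟨g u, ?_, g v, ?_, g w, ?_, by simp only [map_add, map_smul]⟩ <;>
    rw [← map_eigSp g hg] <;> exact ⟨_, ‹_›, rfl⟩

variable (F) in
/-- A bi-infinite sequence of axes, each equipped with an algebra automorphism inverting its
odd part and reflecting the sequence. -/
structure AxisChain (α β : F) (a : ℤ → V) : Prop where
  axis : ∀ l, IsAxis F α β (a l)
  reflection : ∀ l, ∃ τ : V ≃ₗ[F] V, (∀ x y, τ (x * y) = τ x * τ y) ∧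
    (∀ j, τ (a j) = a (2 * l - j)) ∧ (∀ x ∈ plusPart F α (a l), τ x = x) ∧
    ∀ x ∈ eigSp F (a l) β, τ x = -x

theorem axSeq_two_mul (α β : F) (a₀ a₁ : V) (i : ℤ) : axSeq F α β a₀ a₁ (2 * i) =
    ((miyamoto F α β a₁ * miyamoto F α β a₀) ^ i) a₀ := by
  rw [axSeq, if_pos (by omega), show 2 * i / 2 = i by omega]

theorem axSeq_two_mul_add_one (α β : F) (a₀ a₁ : V) (i : ℤ) : axSeq F α β a₀ a₁ (2 * i + 1) =
    ((miyamoto F α β a₁ * miyamoto F α β a₀) ^ i) a₁ := by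
  rw [axSeq, if_neg (by omega), show (2 * i + 1) / 2 = i by omega]

theorem zpow_miyamoto_axSeq (α β : F) (a₀ a₁ : V) (i j : ℤ) :
    ((miyamoto F α β a₁ * miyamoto F α β a₀) ^ i) (axSeq F α β a₀ a₁ j) =
      axSeq F α β a₀ a₁ (j + 2 * i) := by
  rw [axSeq, axSeq, show (j + 2 * i) / 2 = i + j / 2 by omega,
    show (j + 2 * i) % 2 = j % 2 by omega, zpow_add, LinearEquiv.mul_apply]

theorem IsTwoGenerated.axisChain {α β : F} (h0 : β ≠ 0) (h1 : β ≠ 1) (hα : β ≠ α) {a₀ a₁ : V}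
    (h : IsTwoGenerated F α β a₀ a₁) : AxisChain F α β (axSeq F α β a₀ a₁) := by
  set t₀ := miyamoto F α β a₀ with ht₀
  set t₁ := miyamoto F α β a₁ with ht₁
  have mul₀ : ∀ x y, t₀ (x * y) = t₀ x * t₀ y := h.axis₀.miyamoto_mul h0 h1 hα
  have mul₁ : ∀ x y, t₁ (x * y) = t₁ x * t₁ y := h.axis₁.miyamoto_mul h0 h1 hα
  have inv₀ : t₀⁻¹ = t₀ := inv_eq_of_mul_eq_one_left
    (LinearEquiv.ext fun x => h.axis₀.miyamoto_miyamoto h0 h1 hα x)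
  have sq₁ : t₁ * t₁ = 1 := LinearEquiv.ext fun x => h.axis₁.miyamoto_miyamoto h0 h1 hα x
  have inv₁ : t₁⁻¹ = t₁ := inv_eq_of_mul_eq_one_left sq₁
  have fix₀ : t₀ a₀ = a₀ := miyamoto_of_mem_plus h0 h1 hα h.axis₀ h.axis₀.self_mem_plusPart
  have fix₁ : t₁ a₁ = a₁ := miyamoto_of_mem_plus h0 h1 hα h.axis₁ h.axis₁.self_mem_plusPart
  have mulr : ∀ (i : ℤ) (x y : V), ((t₁ * t₀) ^ i) (x * y) =
      ((t₁ * t₀) ^ i) x * ((t₁ * t₀) ^ i) y := by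
    intro i
    induction i using Int.induction_on with
    | zero => intro x y; rfl
    | succ n ih =>
      intro x y
      simp only [zpow_add_one, LinearEquiv.mul_apply, mul₀, mul₁, ih]
    | pred n ih =>
      intro x y
      simp only [zpow_sub_one, mul_inv_rev, inv₀, inv₁, LinearEquiv.mul_apply, mul₀, mul₁, ih]
  have conj₀ : ∀ i : ℤ, t₀ * (t₁ * t₀) ^ i = (t₁ * t₀) ^ (-i) * t₀ := by
    intro i
    have : SemiconjBy t₀ (t₁ * t₀) (t₁ * t₀)⁻¹ := by
      rw [SemiconjBy, mul_inv_rev, inv₀, inv₁, mul_assoc]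
    rw [zpow_neg, ← inv_zpow]
    exact this.zpow_right i
  have conj₁ : ∀ i : ℤ, t₁ * (t₁ * t₀) ^ i = (t₁ * t₀) ^ (-i) * t₁ := by
    intro i
    have : SemiconjBy t₁ (t₁ * t₀) (t₁ * t₀)⁻¹ := by
      rw [SemiconjBy, mul_inv_rev, inv₀, inv₁, mul_assoc, ← mul_assoc t₁ t₁ t₀, sq₁, one_mul,
        mul_one]
    rw [zpow_neg, ← inv_zpow]
    exact this.zpow_right i
  have ref₀ : ∀ j, t₀ (axSeq F α β a₀ a₁ j) = axSeq F α β a₀ a₁ (-j) := by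
    intro j
    obtain ⟨i, rfl | rfl⟩ := Int.even_or_odd' j
    · rw [show -(2 * i) = 2 * (-i) by ring, axSeq_two_mul, axSeq_two_mul, ← LinearEquiv.mul_apply,
        conj₀, LinearEquiv.mul_apply, fix₀]
    · rw [show -(2 * i + 1) = 2 * (-i - 1) + 1 by ring, axSeq_two_mul_add_one,
        axSeq_two_mul_add_one, ← LinearEquiv.mul_apply, conj₀, zpow_sub_one, mul_inv_rev, inv₀,
        inv₁, LinearEquiv.mul_apply, LinearEquiv.mul_apply, LinearEquiv.mul_apply, fix₁]
  have ref₁ : ∀ j, t₁ (axSeq F α β a₀ a₁ j) = axSeq F α β a₀ a₁ (2 - j) := by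
    intro j
    obtain ⟨i, rfl | rfl⟩ := Int.even_or_odd' j
    · rw [show 2 - 2 * i = 2 * (-i + 1) by ring, axSeq_two_mul, axSeq_two_mul,
        ← LinearEquiv.mul_apply, conj₁, zpow_add_one, LinearEquiv.mul_apply,
        LinearEquiv.mul_apply, LinearEquiv.mul_apply, fix₀]
    · rw [show 2 - (2 * i + 1) = 2 * (-i) + 1 by ring, axSeq_two_mul_add_one,
        axSeq_two_mul_add_one, ← LinearEquiv.mul_apply, conj₁, LinearEquiv.mul_apply, fix₁]
  have main : ∀ (b : V) (t : V ≃ₗ[F] V) (k i : ℤ), IsAxis F α β b → t = miyamoto F α β b →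
      axSeq F α β a₀ a₁ (k + 2 * i) = ((t₁ * t₀) ^ i) b →
      (∀ j, t (axSeq F α β a₀ a₁ j) = axSeq F α β a₀ a₁ (2 * k - j)) →
      IsAxis F α β (axSeq F α β a₀ a₁ (k + 2 * i)) ∧
      ∃ τ : V ≃ₗ[F] V, (∀ x y, τ (x * y) = τ x * τ y) ∧
      (∀ j, τ (axSeq F α β a₀ a₁ j) = axSeq F α β a₀ a₁ (2 * (k + 2 * i) - j)) ∧
      (∀ x ∈ plusPart F α (axSeq F α β a₀ a₁ (k + 2 * i)), τ x = x) ∧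
      ∀ x ∈ eigSp F (axSeq F α β a₀ a₁ (k + 2 * i)) β, τ x = -x := by
    rintro b t k i hb rfl hk ht
    rw [hk]
    refine ⟨hb.map _ (mulr i), (t₁ * t₀) ^ i * miyamoto F α β b * (t₁ * t₀) ^ (-i), ?_, ?_, ?_, ?_⟩
    · intro x y
      simp only [LinearEquiv.mul_apply, mulr, hb.miyamoto_mul h0 h1 hα]
    · intro j
      simp only [LinearEquiv.mul_apply]
      rw [zpow_miyamoto_axSeq, ht, zpow_miyamoto_axSeq]
      congr 1
      ring
    · simp only [plusPart, ← map_eigSp _ (mulr i), ← Submodule.map_sup]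
      rintro _ ⟨x, hx, rfl⟩
      rw [LinearEquiv.mul_apply, LinearEquiv.mul_apply]
      change _ = ((t₁ * t₀) ^ i) x
      rw [← miyamoto_of_mem_plus h0 h1 hα hb hx]
      congr 2
      change ((t₁ * t₀) ^ (-i)) (((t₁ * t₀) ^ i) _) = _
      rw [← LinearEquiv.mul_apply, ← zpow_add, neg_add_cancel, zpow_zero,
        miyamoto_of_mem_plus h0 h1 hα hb hx]
      rfl
    · simp only [← map_eigSp _ (mulr i)]
      rintro _ ⟨x, hx, rfl⟩
      rw [LinearEquiv.mul_apply, LinearEquiv.mul_apply]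
      change _ = -((t₁ * t₀) ^ i) x
      rw [← map_neg, ← miyamoto_of_mem_minus h0 h1 hα hb hx]
      congr 2
      change ((t₁ * t₀) ^ (-i)) (((t₁ * t₀) ^ i) _) = _
      rw [← LinearEquiv.mul_apply, ← zpow_add, neg_add_cancel, zpow_zero]
      rfl
  have all : ∀ l, IsAxis F α β (axSeq F α β a₀ a₁ l) ∧
      ∃ τ : V ≃ₗ[F] V, (∀ x y, τ (x * y) = τ x * τ y) ∧
      (∀ j, τ (axSeq F α β a₀ a₁ j) = axSeq F α β a₀ a₁ (2 * l - j)) ∧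
      (∀ x ∈ plusPart F α (axSeq F α β a₀ a₁ l), τ x = x) ∧
      ∀ x ∈ eigSp F (axSeq F α β a₀ a₁ l) β, τ x = -x := by
    intro l
    obtain ⟨i, rfl | rfl⟩ := Int.even_or_odd' l
    · rw [← zero_add (2 * i)]
      exact main a₀ t₀ 0 i h.axis₀ ht₀ (by rw [zero_add, axSeq_two_mul])
        (fun j => by rw [ref₀, mul_zero, zero_sub])
    · rw [add_comm]
      exact main a₁ t₁ 1 i h.axis₁ ht₁ (by rw [add_comm, axSeq_two_mul_add_one])
        (fun j => by rw [ref₁, mul_one])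
  exact ⟨fun l => (all l).1, fun l => (all l).2⟩

theorem exists_mul_eq_of_fusion (h2 : (2 : F) ≠ 0) {e : V} (he : IsAxis F 2 (1 / 2) e)
    {pj pk pm pn sj sk sm sn T S : V}
    (hepj : e * pj = (2 : F) • sj + e + (1 / 2 : F) • pj)
    (hepk : e * pk = (2 : F) • sk + e + (1 / 2 : F) • pk)
    (hepm : e * pm = (2 : F) • sm + e + (1 / 2 : F) • pm)
    (hepn : e * pn = (2 : F) • sn + e + (1 / 2 : F) • pn)
    (hesj : e * sj = (3 / 2 : F) • sj + (3 / 8 : F) • pj - (3 / 4 : F) • e)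
    (hesk : e * sk = (3 / 2 : F) • sk + (3 / 8 : F) • pk - (3 / 4 : F) • e)
    (heT : e * T = (3 : F) • sm + (3 / 4 : F) • pm - (3 / 2 : F) • e)
    (hpp : pj * pk = T + S + pj + pk)
    (hps : pj * sk = (3 : F) • sk + (3 / 8 : F) • (pn + pm) - (3 / 4 : F) • pj)
    (hsp : sj * pk = (3 : F) • sj + (3 / 8 : F) • (pn + pm) - (3 / 4 : F) • pk) :
    ∃ μ : F,
      e * S = (3 : F) • sn + (3 / 4 : F) • pn - (3 / 2 + 2 * μ) • e ∧
      sj * sk = (3 / 4 : F) • (sj + sk) - (3 / 4 : F) • (sm + sn) + (3 / 16 : F) • (T + S)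
        + (3 / 4 * μ) • e ∧
      ((3 / 4 : F) • pj - sj - (3 / 2 : F) • e) * (sk + (1 / 4 : F) • pk - (1 / 2 : F) • e)
        ∈ eigSp F e 2 := by
  have h4 : (4 : F) ≠ 0 := by rw [show (4 : F) = 2 * 2 by norm_num]; exact mul_ne_zero h2 h2
  have h8 : (8 : F) ≠ 0 := by rw [show (8 : F) = 2 * 4 by norm_num]; exact mul_ne_zero h2 h4
  have h16 : (16 : F) ≠ 0 := by rw [show (16 : F) = 2 * 8 by norm_num]; exact mul_ne_zero h2 h8
  have hu : ∀ {p s : V}, e * p = (2 : F) • s + e + (1 / 2 : F) • p →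
      e * s = (3 / 2 : F) • s + (3 / 8 : F) • p - (3 / 4 : F) • e →
      (3 / 4 : F) • p - s - (3 / 2 : F) • e ∈ eigSp F e 0 := by
    intro p s hp hs
    change e * _ = (0 : F) • _
    rw [mul_sub, mul_sub, mul_smul_comm, mul_smul_comm, hp, hs, he.idem]
    match_scalars <;> field_simp <;> ring
  have hv : ∀ {p s : V}, e * p = (2 : F) • s + e + (1 / 2 : F) • p →
      e * s = (3 / 2 : F) • s + (3 / 8 : F) • p - (3 / 4 : F) • e →
      s + (1 / 4 : F) • p - (1 / 2 : F) • e ∈ eigSp F e 2 := by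
    intro p s hp hs
    change e * _ = (2 : F) • _
    rw [mul_sub, mul_add, mul_smul_comm, mul_smul_comm, hp, hs, he.idem]
    match_scalars <;> field_simp <;> ring
  have z1 : e * _ = (0 : F) • _ := he.fusion_zero_zero _ (hu hepj hesj) _ (hu hepk hesk)
  have m2 := he.fusion_zero_alpha _ (hu hepj hesj) _ (hv hepk hesk)
  have z2 : e * _ = (2 : F) • _ := m2
  have z3 : e * _ = (2 : F) • _ := he.fusion_zero_alpha _ (hu hepk hesk) _ (hv hepj hesj)
  have z4 := he.fusion_alpha_alpha _ (hv hepj hesj) _ (hv hepk hesk)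
  rw [he.primitive] at z4
  obtain ⟨y, hy, z, hz, z4⟩ := Submodule.mem_sup.1 z4
  obtain ⟨μ, rfl⟩ := Submodule.mem_span_singleton.1 hy
  have hz : e * z = (0 : F) • z := hz
  replace z4 := congrArg (e * ·) z4
  simp only [mul_add, hz, mul_smul_comm, he.idem] at z4
  rw [mul_comm ((3 / 4 : F) • pk - sk - (3 / 2 : F) • e)] at z3
  simp only [mul_add, mul_sub, add_mul, sub_mul, smul_mul_assoc, mul_smul_comm, mul_comm _ e, hpp,
    hps, hsp, hepj, hepk, hepm, hepn, hesj, hesk, heT, he.idem, smul_add, smul_sub] at z1 z2 z3 z4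
  have key : e * S = (3 : F) • sn + (3 / 4 : F) • pn - (3 / 2 + 2 * μ) • e := by
    linear_combination (norm := skip) (2 : F) • z1 + (2 : F) • z2 - (2 : F) • z3 + (2 : F) • z4
    match_scalars <;> field_simp <;> ring
  refine ⟨μ, key, ?_, m2⟩
  rw [key] at z1 z2
  linear_combination (norm := skip) (1 / 2 : F) • z1 + (1 / 2 : F) • z2
  match_scalars <;> field_simp <;> ring

theorem mul_eq_of_fusion (h2 : (2 : F) ≠ 0) (h3 : (3 : F) ≠ 0) {e : V} (he : IsAxis F 2 (1 / 2) e)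
    {f : V →ₗ[F] F} (hfe : f e = 1) (hf : ∀ x, f (e * x) = f x) {ε : F}
    {pj pk pm pn sj sk sm sn T S : V}
    (hepj : e * pj = (2 : F) • sj + e + (1 / 2 : F) • pj)
    (hepk : e * pk = (2 : F) • sk + e + (1 / 2 : F) • pk)
    (hepm : e * pm = (2 : F) • sm + e + (1 / 2 : F) • pm)
    (hepn : e * pn = (2 : F) • sn + e + (1 / 2 : F) • pn)
    (hesj : e * sj = (3 / 2 : F) • sj + (3 / 8 : F) • pj - (3 / 4 : F) • e)
    (hesk : e * sk = (3 / 2 : F) • sk + (3 / 8 : F) • pk - (3 / 4 : F) • e)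
    (heT : e * T = (3 : F) • sm + (3 / 4 : F) • pm - (3 / 2 : F) • e)
    (hpp : pj * pk = T + S + pj + pk)
    (hps : pj * sk = (3 : F) • sk + (3 / 8 : F) • (pn + pm) - (3 / 4 : F) • pj)
    (hsp : sj * pk = (3 : F) • sj + (3 / 8 : F) • (pn + pm) - (3 / 4 : F) • pk)
    (hfpj : f pj = 2) (hfpk : f pk = 2) (hfpm : f pm = 2) (hfpn : f pn = 2 * (1 + ε))
    (hfsj : f sj = 0) (hfsk : f sk = 0) (hfsm : f sm = 0) (hfsn : f sn = ε / 2) :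
    e * S = (3 : F) • sn + (3 / 4 : F) • pn - (3 / 2 + 2 * ε) • e ∧
      sj * sk = (3 / 4 : F) • (sj + sk) - (3 / 4 : F) • (sm + sn) + (3 / 16 : F) • (T + S)
        + (3 / 4 * ε) • e := by
  have h4 : (4 : F) ≠ 0 := by rw [show (4 : F) = 2 * 2 by norm_num]; exact mul_ne_zero h2 h2
  have h8 : (8 : F) ≠ 0 := by rw [show (8 : F) = 2 * 4 by norm_num]; exact mul_ne_zero h2 h4
  have h16 : (16 : F) ≠ 0 := by rw [show (16 : F) = 2 * 8 by norm_num]; exact mul_ne_zero h2 h8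
  obtain ⟨μ, hS, hX, hmem⟩ := exists_mul_eq_of_fusion h2 he hepj hepk hepm hepn hesj hesk heT
    hpp hps hsp
  have hfT := hf T
  have hfS := hf S
  have hfm : e * _ = (2 : F) • _ := hmem
  replace hfm := congrArg f hfm
  rw [hf, map_smul, smul_eq_mul] at hfm
  have hm : f (((3 / 4 : F) • pj - sj - (3 / 2 : F) • e)
      * (sk + (1 / 4 : F) • pk - (1 / 2 : F) • e)) = 0 := by linear_combination -hfm
  simp only [heT, hS, map_add, map_sub, map_smul, smul_eq_mul, hfpm, hfpn,
    hfsm, hfsn, hfe] at hfT hfS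
  simp only [mul_add, mul_sub, add_mul, sub_mul, smul_mul_assoc, mul_smul_comm, mul_comm _ e, hpp,
    hps, hsp, hepj, hepk, hesj, hesk, he.idem, hX, map_add, map_sub, map_smul, smul_eq_mul,
    hfpj, hfpk, hfpm, hfpn, hfsj, hfsk, hfsm, hfsn, hfe, ← hfT, ← hfS] at hm
  have hμ : μ = ε := by
    have h6 : (3 / 4 : F) ≠ 0 := div_ne_zero h3 h4
    apply mul_left_cancel₀ h6
    linear_combination (norm := skip) -hm
    field_simp
    ring
  rw [← hμ]
  exact ⟨hS, hX⟩

theorem IsAxis.exists_linearMap (h2 : (2 : F) ≠ 0) {e : V} (he : IsAxis F 2 (1 / 2) e)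
    (hne : e ≠ 0) : ∃ f : V →ₗ[F] F, f e = 1 ∧ ∀ x, f (e * x) = f x := by
  obtain ⟨g, hg⟩ := LinearMap.exists_leftInverse_of_injective (LinearMap.toSpanSingleton F V e)
    (LinearMap.ker_eq_bot.2 (smul_left_injective F hne))
  have hge : g e = 1 := by
    have := LinearMap.congr_fun hg 1
    simpa using this
  set A := LinearMap.mulLeft F e with hA
  have hAe : ∀ x, A x = e * x := fun x => rfl
  refine ⟨(-2 : F) • (g ∘ₗ A ∘ₗ (A - (2 : F) • LinearMap.id) ∘ₗ (A - (1 / 2 : F) • LinearMap.id)),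
    ?_, ?_⟩
  · simp only [LinearMap.smul_apply, LinearMap.comp_apply, LinearMap.sub_apply, LinearMap.id_apply,
      map_sub, map_smul, hAe, mul_sub, mul_smul_comm, he.idem, hge, smul_eq_mul]
    field_simp
    ring
  · intro x
    obtain ⟨y, hy, w, hw, rfl⟩ : ∃ y ∈ plusPart F 2 e, ∃ w ∈ eigSp F e (1 / 2), y + w = x :=
      Submodule.mem_sup.1 (he.decomp ▸ Submodule.mem_top)
    obtain ⟨u, hu, v, hv, z, hz, rfl⟩ := mem_plusPart.1 hy
    have hu : e * u = (1 : F) • u := hu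
    have hv : e * v = (0 : F) • v := hv
    have hw : e * w = (1 / 2 : F) • w := hw
    have hz : e * z = (2 : F) • z := hz
    simp only [LinearMap.smul_apply, LinearMap.comp_apply, LinearMap.sub_apply, LinearMap.id_apply,
      map_sub, map_smul, hAe, mul_sub, mul_add, mul_smul_comm, hu, hv, hw, hz, map_add, smul_eq_mul]
    ring

theorem apply_eq_zero_of_mem_eigSp {e : V} {f : V →ₗ[F] F} (hf : ∀ x, f (e * x) = f x) {μ : F}
    (hμ : μ ≠ 1) {x : V} (hx : x ∈ eigSp F e μ) : f x = 0 := by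
  have hx : e * x = μ • x := hx
  have := hf x
  rw [hx, map_smul, smul_eq_mul] at this
  have h : (μ - 1) * f x = 0 := by linear_combination this
  exact (mul_eq_zero.1 h).resolve_left (sub_ne_zero.2 hμ)

theorem half_ne_one : (1 / 2 : F) ≠ 1 := by
  intro h
  by_cases h2 : (2 : F) = 0
  · simp [h2] at h
  · field_simp at h
    exact one_ne_zero (by linear_combination -h : (1 : F) = 0)

theorem two_ne_one : (2 : F) ≠ 1 := fun h => one_ne_zero (by linear_combination h : (1 : F) = 0)

theorem IsAxis.hasProj_iff {e : V} (he : IsAxis F 2 (1 / 2) e)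
    {f : V →ₗ[F] F} (hfe : f e = 1) (hf : ∀ x, f (e * x) = f x) {x : V} {c : F} :
    HasProj F 2 (1 / 2) e x c ↔ f x = c := by
  have key : ∀ {x c}, HasProj F 2 (1 / 2) e x c → f x = c := by
    rintro _ c ⟨u, hu, v, hv, w, hw, rfl⟩
    rw [map_add, map_add, map_add, map_smul, hfe,
      apply_eq_zero_of_mem_eigSp hf zero_ne_one hu, apply_eq_zero_of_mem_eigSp hf two_ne_one hv,
      apply_eq_zero_of_mem_eigSp hf half_ne_one hw]
    simp
  refine ⟨key, ?_⟩
  rintro rfl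
  obtain ⟨y, hy, w, hw, rfl⟩ : ∃ y ∈ plusPart F 2 e, ∃ w ∈ eigSp F e (1 / 2), y + w = x :=
    Submodule.mem_sup.1 (he.decomp ▸ Submodule.mem_top)
  obtain ⟨u, hu, v, hv, z, hz, rfl⟩ := mem_plusPart.1 hy
  rw [he.primitive] at hu
  obtain ⟨c, rfl⟩ := Submodule.mem_span_singleton.1 hu
  have hp : HasProj F 2 (1 / 2) e (c • e + v + z + w) c := ⟨v, hv, z, hz, w, hw, rfl⟩
  rwa [key hp]

variable (F) in
/-- The elements `s_{r,n}` attached to a sequence of axes. -/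
def chainS (a : ℤ → V) (r n : ℤ) : V :=
  a r * a (r + n) - (1 / 2 : F) • (a r + a (r + n))

/-- A chain of axes of Monster type `(2, 1/2)` with projection functionals `lam l` onto `a l`
taking the value `1` on neighbours at distance at most two. -/
structure IsUnitChain (a : ℤ → V) (lam : ℤ → V →ₗ[F] F) : Prop
    extends AxisChain F 2 (1 / 2) a where
  two_ne : (2 : F) ≠ 0
  three_ne : (3 : F) ≠ 0
  lam_self : ∀ l, lam l (a l) = 1
  lam_mul : ∀ l x, lam l (a l * x) = lam l x
  lam_add_one : ∀ l, lam l (a (l + 1)) = 1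
  lam_add_two : ∀ l, lam l (a (l + 2)) = 1

namespace IsUnitChain

variable {a : ℤ → V} {lam : ℤ → V →ₗ[F] F}

theorem four_ne (H : IsUnitChain a lam) : (4 : F) ≠ 0 := by
  rw [show (4 : F) = 2 * 2 by norm_num]; exact mul_ne_zero H.two_ne H.two_ne

theorem eight_ne (H : IsUnitChain a lam) : (8 : F) ≠ 0 := by
  rw [show (8 : F) = 2 * 4 by norm_num]; exact mul_ne_zero H.two_ne H.four_ne

theorem sixteen_ne (H : IsUnitChain a lam) : (16 : F) ≠ 0 := by
  rw [show (16 : F) = 2 * 8 by norm_num]; exact mul_ne_zero H.two_ne H.eight_ne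

theorem exists_reflection (H : IsUnitChain a lam) (l : ℤ) : ∃ τ : V ≃ₗ[F] V,
    (∀ x y, τ (x * y) = τ x * τ y) ∧ (∀ j, τ (a j) = a (2 * l - j)) ∧
    ∀ x, ∃ y ∈ plusPart F 2 (a l), ∃ w ∈ eigSp F (a l) (1 / 2), x = y + w ∧ τ x = y - w := by
  obtain ⟨τ, hm, ha, hp, hn⟩ := H.reflection l
  refine ⟨τ, hm, ha, fun x => ?_⟩
  obtain ⟨y, hy, w, hw, rfl⟩ : ∃ y ∈ plusPart F 2 (a l), ∃ w ∈ eigSp F (a l) (1 / 2), y + w = x :=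
    Submodule.mem_sup.1 ((H.axis l).decomp ▸ Submodule.mem_top)
  exact ⟨y, hy, w, hw, rfl, by rw [map_add, hp y hy, hn w hw, sub_eq_add_neg]⟩

theorem sub_mem_eigSp (H : IsUnitChain a lam) (l j : ℤ) :
    a (l + j) - a (l - j) ∈ eigSp F (a l) (1 / 2) := by
  obtain ⟨τ, -, ha, hd⟩ := H.exists_reflection l
  obtain ⟨y, -, w, hw, h1, h2⟩ := hd (a (l + j))
  rw [ha, show 2 * l - (l + j) = l - j by ring] at h2
  rw [h1, h2, show y + w - (y - w) = (2 : F) • w by module]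
  exact Submodule.smul_mem _ _ hw

theorem mul_sub_eq (H : IsUnitChain a lam) (l j : ℤ) :
    a l * a (l + j) - a l * a (l - j) = (1 / 2 : F) • (a (l + j) - a (l - j)) := by
  rw [← mul_sub]
  exact H.sub_mem_eigSp l j

theorem chainS_neg (H : IsUnitChain a lam) (r n : ℤ) : chainS F a r (-n) = chainS F a r n := by
  have := H.mul_sub_eq r n
  rw [chainS, chainS, ← sub_eq_add_neg]
  linear_combination (norm := module) -this

theorem chainS_abs (H : IsUnitChain a lam) (r n : ℤ) : chainS F a r |n| = chainS F a r n := by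
  rcases abs_choice n with h | h <;> rw [h]
  exact H.chainS_neg r n

theorem chainS_add_self (H : IsUnitChain a lam) (r n : ℤ) :
    chainS F a (r + n) n = chainS F a r n := by
  rw [← H.chainS_neg (r + n) n, chainS, chainS, add_neg_cancel_right, mul_comm, add_comm (a r)]

theorem chainS_sub_mem (H : IsUnitChain a lam) (l j n : ℤ) :
    a l * (chainS F a (l + j) n - chainS F a (l - j) n) =
      (1 / 2 : F) • (chainS F a (l + j) n - chainS F a (l - j) n) := by
  obtain ⟨τ, hm, ha, hd⟩ := H.exists_reflection l
  obtain ⟨y, -, w, hw, h1, h2⟩ := hd (chainS F a (l + j) n)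
  have ht : τ (chainS F a (l + j) n) = chainS F a (l - j) n := by
    rw [← H.chainS_neg (l - j) n, chainS, chainS, map_sub, map_smul, map_add, hm, ha, ha,
      show 2 * l - (l + j) = l - j by ring, show 2 * l - (l + j + n) = l - j + -n by ring]
  rw [ht] at h2
  have hw : a l * w = (1 / 2 : F) • w := hw
  rw [h1, h2, show y + w - (y - w) = (2 : F) • w by module, mul_smul_comm, hw, smul_comm]

theorem mul_add_eq (H : IsUnitChain a lam) (l n : ℤ) :
    a l * (a (l + n) + a (l - n)) =
      (2 : F) • chainS F a l n + a l + (1 / 2 : F) • (a (l + n) + a (l - n)) := by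
  have h2 := H.two_ne
  have := H.mul_sub_eq l n
  rw [chainS, mul_add]
  linear_combination (norm := skip) -this
  match_scalars <;> field_simp <;> ring

theorem lam_eq_zero (H : IsUnitChain a lam) (l : ℤ) {x : V} (hx : a l * x = (1 / 2 : F) • x) :
    lam l x = 0 :=
  apply_eq_zero_of_mem_eigSp (H.lam_mul l) half_ne_one (x := x) (e := a l) hx

theorem lam_sub (H : IsUnitChain a lam) (l n : ℤ) : lam l (a (l - n)) = lam l (a (l + n)) := by
  have := H.lam_eq_zero l (x := a (l + n) - a (l - n)) (H.sub_mem_eigSp l n)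
  rw [map_sub] at this
  linear_combination -this

theorem lam_chainS (H : IsUnitChain a lam) (l n : ℤ) :
    lam l (chainS F a l n) = (lam l (a (l + n)) - 1) / 2 := by
  have h2 := H.two_ne
  have h := congrArg (lam l) (H.mul_add_eq l n)
  rw [H.lam_mul] at h
  simp only [map_add, map_smul, smul_eq_mul, H.lam_self, H.lam_sub] at h
  field_simp at h
  rw [eq_div_iff h2]
  apply mul_left_cancel₀ h2
  linear_combination -h

theorem lam_add_two_index (H : IsUnitChain a lam) (l n : ℤ) :
    lam (l + 2) (a (l + 2 + n)) = lam l (a (l + n)) := by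
  obtain ⟨τ, hm, ha, -⟩ := H.reflection (l + 1)
  have h := ((H.axis l).hasProj_iff (H.lam_self l) (H.lam_mul l)).2 (rfl : lam l (a (l + n)) = _)
  have h' := h.map τ hm
  rw [ha, ha, show 2 * (l + 1) - l = l + 2 by ring,
    show 2 * (l + 1) - (l + n) = l + 2 - n by ring,
    (H.axis _).hasProj_iff (H.lam_self _) (H.lam_mul _), H.lam_sub] at h'
  exact h'

theorem mul_chainS_self (H : IsUnitChain a lam) (l n : ℤ) (hn : lam l (a (l + n)) = 1) :
    a l * chainS F a l n = (3 / 2 : F) • chainS F a l n + (3 / 8 : F) • (a (l + n) + a (l - n))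
      - (3 / 4 : F) • a l := by
  have h2 := H.two_ne
  have h4 := H.four_ne
  have h8 := H.eight_ne
  obtain ⟨τ, -, ha, hp, hm⟩ := H.reflection l
  obtain ⟨u, hu, v, hv, w, hw, h1⟩ :=
    ((H.axis l).hasProj_iff (H.lam_self l) (H.lam_mul l)).2 hn
  have hpos : (1 : F) • a l + u + v ∈ plusPart F 2 (a l) :=
    mem_plusPart.2 ⟨_, Submodule.smul_mem _ _ (H.axis l).self_mem_eigSp, u, hu, v, hv, rfl⟩
  have h3 := ha (l + n)
  rw [h1, map_add, hp _ hpos, hm w hw, show 2 * l - (l + n) = l - n by ring] at h3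
  have hu : a l * u = (0 : F) • u := hu
  have hv : a l * v = (2 : F) • v := hv
  have hw : a l * w = (1 / 2 : F) • w := hw
  rw [chainS, ← h3, h1]
  simp only [mul_sub, mul_add, mul_smul_comm, hu, hv, hw, (H.axis l).idem]
  match_scalars <;> field_simp <;> ring

end IsUnitChain

variable (F) in
/-- Sequences of period `3` which are constant unless `5 = 0` in `F`. -/
structure IsTriperiodic (f : ℤ → V) : Prop where
  periodic : Function.Periodic f 3
  five_smul : ∀ l, (5 : F) • f (l + 1) = (5 : F) • f l

namespace IsTriperiodic

variable {f g : ℤ → V}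

theorem five_smul_eq (hf : IsTriperiodic F f) (r t : ℤ) : (5 : F) • f r = (5 : F) • f t := by
  have h : Function.Periodic (fun l => (5 : F) • f l) 1 := hf.five_smul
  have := h.int_mul (r - t) t
  simpa using this

theorem add (hf : IsTriperiodic F f) (hg : IsTriperiodic F g) :
    IsTriperiodic F fun l => f l + g l :=
  ⟨fun l => by simp only [hf.periodic l, hg.periodic l],
    fun l => by simp only [smul_add, hf.five_smul l, hg.five_smul l]⟩

theorem smul (c : F) (hf : IsTriperiodic F f) : IsTriperiodic F fun l => c • f l :=
  ⟨fun l => by simp only [hf.periodic l],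
    fun l => by simp only [smul_comm (5 : F) c, hf.five_smul l]⟩

theorem mul (hf : IsTriperiodic F f) (hg : IsTriperiodic F g) :
    IsTriperiodic F fun l => f l * g l :=
  ⟨fun l => by simp only [hf.periodic l, hg.periodic l],
    fun l => by rw [← smul_mul_assoc, hf.five_smul l, smul_mul_assoc, ← mul_smul_comm,
      hg.five_smul l, mul_smul_comm]⟩

theorem shift (hf : IsTriperiodic F f) (j : ℤ) : IsTriperiodic F fun l => f (l + j) :=
  ⟨fun l => by simp only [add_right_comm l 3 j, hf.periodic (l + j)],
    fun l => by simp only [add_right_comm l 1 j, hf.five_smul (l + j)]⟩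

theorem eq_of_modEq (hf : IsTriperiodic F f) {r t : ℤ} (h : (3 : ℤ) ∣ r - t) : f r = f t := by
  obtain ⟨q, hq⟩ := h
  have := hf.periodic.int_mul q t
  rw [show r = t + q * 3 by linarith]
  exact this

theorem eq_of_ne (hf : IsTriperiodic F f) (h5 : (5 : F) ≠ 0) (r t : ℤ) : f r = f t :=
  smul_right_injective V h5 (hf.five_smul_eq r t)

theorem eq_of_periodic (hf : IsTriperiodic F f) {n : ℤ} (hn : Function.Periodic f n)
    (h : (5 : F) ≠ 0 ∨ ¬ (3 : ℤ) ∣ n) (r t : ℤ) : f r = f t := by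
  by_cases h5 : (5 : F) = 0
  · have h3 := h.resolve_left (not_not.2 h5)
    have h1 := hn.int_mul ((r - t) * n) t
    rw [Int.cast_id] at h1
    rw [← h1]
    apply hf.eq_of_modEq
    have hsq : (3 : ℤ) ∣ n * n - 1 := by
      have : n % 3 = 1 ∨ n % 3 = 2 := by omega
      rw [Int.dvd_iff_emod_eq_zero, Int.sub_emod, Int.mul_emod]
      rcases this with h | h <;> rw [h] <;> rfl
    rw [show r - (t + (r - t) * n * n) = -(r - t) * (n * n - 1) by ring]
    exact hsq.mul_left _
  · exact hf.eq_of_ne h5 r t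

end IsTriperiodic

namespace IsUnitChain

variable {a : ℤ → V} {lam : ℤ → V →ₗ[F] F}

/-- The multiplication rules of the Highwater algebra and its cover, at distance `n`. -/
structure Regular (a : ℤ → V) (lam : ℤ → V →ₗ[F] F) (n : ℤ) : Prop where
  lam_eq : ∀ l, lam l (a (l + n)) = 1
  tri : IsTriperiodic F fun l => chainS F a l n
  mul_symm : ∀ l j, a l * (chainS F a (l + j) n + chainS F a (l - j) n) =
    (3 : F) • chainS F a l n + (3 / 4 : F) • (a (l + n) + a (l - n)) - (3 / 2 : F) • a l

theorem periodic_chainS (H : IsUnitChain a lam) (n : ℤ) :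
    Function.Periodic (fun l => chainS F a l n) n := fun l => H.chainS_add_self l n

theorem Regular.chainS_eq (H : IsUnitChain a lam) {n : ℤ} (hn : Regular a lam n)
    (h : (5 : F) ≠ 0 ∨ ¬ (3 : ℤ) ∣ n) (r t : ℤ) : chainS F a r n = chainS F a t n :=
  hn.tri.eq_of_periodic (H.periodic_chainS n) h r t

theorem Regular.neg (H : IsUnitChain a lam) {n : ℤ} (hn : Regular a lam n) :
    Regular a lam (-n) where
  lam_eq l := by rw [← sub_eq_add_neg, H.lam_sub, hn.lam_eq]
  tri := by simpa only [H.chainS_neg] using hn.tri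
  mul_symm l j := by
    rw [H.chainS_neg, H.chainS_neg, H.chainS_neg, hn.mul_symm, ← sub_eq_add_neg, sub_neg_eq_add,
      add_comm (a (l - n))]

/-- `a_l s_{r,n}` in terms of reflections in `l`. -/
theorem Regular.mul_chainS (H : IsUnitChain a lam) {n : ℤ} (hn : Regular a lam n) (l r : ℤ) :
    a l * chainS F a r n = (3 / 2 : F) • chainS F a l n
      + (1 / 4 : F) • (chainS F a r n - chainS F a (2 * l - r) n)
      + (3 / 8 : F) • (a (l + n) + a (l - n)) - (3 / 4 : F) • a l := by
  have h2 := H.two_ne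
  have h4 := H.four_ne
  have h8 := H.eight_ne
  have e1 := hn.mul_symm l (r - l)
  have e2 := H.chainS_sub_mem l (r - l) n
  rw [show l + (r - l) = r by ring, show l - (r - l) = 2 * l - r by ring] at e1 e2
  rw [mul_add] at e1
  rw [mul_sub] at e2
  linear_combination (norm := skip) (1 / 2 : F) • e1 + (1 / 2 : F) • e2
  match_scalars <;> field_simp <;> ring

theorem Regular.add_mul_chainS (H : IsUnitChain a lam) {k : ℤ} (hk : Regular a lam k) (l j : ℤ) :
    (a (l + j) + a (l - j)) * chainS F a l k = (3 : F) • chainS F a l k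
      + (3 / 8 : F) • ((a (l + (j + k)) + a (l - (j + k))) + (a (l + (k - j)) + a (l - (k - j))))
      - (3 / 4 : F) • (a (l + j) + a (l - j)) := by
  have h2 := H.two_ne
  have h4 := H.four_ne
  have h8 := H.eight_ne
  have e1 := hk.mul_chainS H (l + j) l
  have e2 := hk.mul_chainS H (l - j) l
  have p1 : chainS F a (2 * (l + j) - l) k = chainS F a (l - j) k :=
    hk.tri.eq_of_modEq ⟨j, by ring⟩
  have p2 : chainS F a (2 * (l - j) - l) k = chainS F a (l + j) k :=
    hk.tri.eq_of_modEq ⟨-j, by ring⟩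
  have f1 := hk.tri.five_smul_eq (l + j) l
  have f2 := hk.tri.five_smul_eq (l - j) l
  rw [p1, show l + j + k = l + (j + k) by ring, show l + j - k = l - (k - j) by ring] at e1
  rw [p2, show l - j + k = l + (k - j) by ring, show l - j - k = l - (j + k) by ring] at e2
  rw [add_mul]
  linear_combination (norm := skip) e1 + e2 + (1 / 4 : F) • f1 + (1 / 4 : F) • f2
  match_scalars <;> field_simp <;> ring

theorem add_mul_add (H : IsUnitChain a lam) (l j k : ℤ) :
    (a (l + j) + a (l - j)) * (a (l + k) + a (l - k)) =
      (chainS F a (l + j) (k - j) + chainS F a (l - j) (k - j))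
      + (chainS F a (l + j) (j + k) + chainS F a (l - j) (j + k))
      + (a (l + j) + a (l - j)) + (a (l + k) + a (l - k)) := by
  have h2 := H.two_ne
  rw [← H.chainS_neg (l - j) (k - j), ← H.chainS_neg (l + j) (j + k)]
  simp only [chainS, show l + j + (k - j) = l + k by ring, show l - j + -(k - j) = l - k by ring,
    show l + j + -(j + k) = l - k by ring, show l - j + (j + k) = l + k by ring, mul_add, add_mul]
  match_scalars <;> field_simp <;> ring

theorem mul_of_regular (H : IsUnitChain a lam) {j k : ℤ} (hj : Regular a lam j)
    (hk : Regular a lam k) (hm : Regular a lam (k - j)) (l : ℤ) :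
    a l * (chainS F a (l + j) (j + k) + chainS F a (l - j) (j + k)) =
      (3 : F) • chainS F a l (j + k) + (3 / 4 : F) • (a (l + (j + k)) + a (l - (j + k)))
        - (3 / 2 + 2 * (lam l (a (l + (j + k))) - 1)) • a l ∧
    chainS F a l j * chainS F a l k = (3 / 4 : F) • (chainS F a l j + chainS F a l k)
      - (3 / 4 : F) • (chainS F a l (k - j) + chainS F a l (j + k))
      + (3 / 16 : F) • ((chainS F a (l + j) (k - j) + chainS F a (l - j) (k - j))
        + (chainS F a (l + j) (j + k) + chainS F a (l - j) (j + k)))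
      + (3 / 4 * (lam l (a (l + (j + k))) - 1)) • a l := by
  have h2 := H.two_ne
  have hps := hk.add_mul_chainS H l j
  have hsp := hj.add_mul_chainS H l k
  rw [mul_comm, show l + (k + j) = l + (j + k) by ring, show l - (k + j) = l - (j + k) by ring,
    show l + (j - k) = l - (k - j) by ring, show l - (j - k) = l + (k - j) by ring,
    add_comm (a (l - (k - j)))] at hsp
  have hpp := H.add_mul_add l j k
  have hp : ∀ n, lam l (a (l + n) + a (l - n)) = 2 * lam l (a (l + n)) := by
    intro n
    rw [map_add, H.lam_sub]
    ring
  have hpr : ∀ {n}, Regular a lam n → lam l (a (l + n) + a (l - n)) = 2 := by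
    intro n hn
    rw [hp, hn.lam_eq, mul_one]
  have hsr : ∀ {n}, Regular a lam n → lam l (chainS F a l n) = 0 := by
    intro n hn
    rw [H.lam_chainS, hn.lam_eq, sub_self, zero_div]
  exact mul_eq_of_fusion h2 H.three_ne (H.axis l) (H.lam_self l) (H.lam_mul l) (H.mul_add_eq l j)
    (H.mul_add_eq l k) (H.mul_add_eq l (k - j)) (H.mul_add_eq l (j + k))
    (H.mul_chainS_self l j (hj.lam_eq l)) (H.mul_chainS_self l k (hk.lam_eq l))
    (hm.mul_symm l j) hpp hps hsp (hpr hj) (hpr hk) (hpr hm)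
    ((hp _).trans (by ring)) (hsr hj) (hsr hk) (hsr hm) (H.lam_chainS l _)

end IsUnitChain

namespace IsUnitChain

variable {a : ℤ → V} {lam : ℤ → V →ₗ[F] F}

theorem second_difference_eq (H : IsUnitChain a lam) {n j k : ℤ} (hn : j + k = n)
    (hj : Regular a lam j) (hk : Regular a lam k) (hm : Regular a lam (k - j)) (l : ℤ) :
    chainS F a (l + j) n + chainS F a (l - j) n - (4 : F) • chainS F a l n
      + (4 : F) • (lam l (a (l + n)) - 1) • a l =
    (16 / 3 : F) • (chainS F a l j * chainS F a l k)
      + (-4 : F) • (chainS F a l j + chainS F a l k) + (4 : F) • chainS F a l (k - j)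
      + (-1 : F) • (chainS F a (l + j) (k - j) + chainS F a (l + -j) (k - j)) := by
  subst hn
  have h2 := H.two_ne
  have h3 := H.three_ne
  have h4 := H.four_ne
  have h16 := H.sixteen_ne
  rw [(H.mul_of_regular hj hk hm l).2, ← sub_eq_add_neg]
  match_scalars <;> field_simp <;> ring

theorem second_difference_tri (H : IsUnitChain a lam) {n j k : ℤ} (hn : j + k = n)
    (hj : Regular a lam j) (hk : Regular a lam k) (hm : Regular a lam (k - j)) :
    IsTriperiodic F fun l => chainS F a (l + j) n + chainS F a (l - j) n - (4 : F) • chainS F a l n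
      + (4 : F) • (lam l (a (l + n)) - 1) • a l := by
  simp only [H.second_difference_eq hn hj hk hm]
  exact ((((hj.tri.mul hk.tri).smul _).add ((hj.tri.add hk.tri).smul _)).add
    (hm.tri.smul _)).add (((hm.tri.shift j).add (hm.tri.shift (-j))).smul _)

/-- If `x (l + 1) + x (l - 1) - 4 x l + 4 b l` and `x (l + 2) + x (l - 2) - 4 x l + 4 b l` are
triperiodic, then `b (l + 2) + b (l - 2) - b (l + 1) - b (l - 1)` does not depend on `l`. -/
theorem _root_.AxialFormal.IsTriperiodic.fourth_difference_eq (h4 : (4 : F) ≠ 0) {x b : ℤ → V}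
    (h1 : IsTriperiodic F fun l => x (l + 1) + x (l - 1) - (4 : F) • x l + (4 : F) • b l)
    (h2 : IsTriperiodic F fun l => x (l + 2) + x (l - 2) - (4 : F) • x l + (4 : F) • b l) (l : ℤ) :
    b (l + 3) + b (l - 1) - b (l + 2) - b l = b (l + 2) + b (l - 2) - b (l + 1) - b (l - 1) := by
  obtain ⟨c, hc⟩ : ∃ c : ℤ → V, ∀ l, c l = x (l + 1) + x (l - 1) - (4 : F) • x l + (4 : F) • b l :=
    ⟨_, fun _ => rfl⟩
  obtain ⟨d, hd⟩ : ∃ d : ℤ → V, ∀ l, d l = x (l + 2) + x (l - 2) - (4 : F) • x l + (4 : F) • b l :=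
    ⟨_, fun _ => rfl⟩
  simp only [← hc, ← hd] at h1 h2
  have key : ∀ l, (4 : F) • (b (l + 2) + b (l - 2) - b (l + 1) - b (l - 1)) =
      c (l + 2) + c (l - 2) - (4 : F) • c l - (d (l + 1) + d (l - 1) - (4 : F) • d l) := by
    intro l
    simp only [hc, hd, show l + 2 + 1 = l + 3 by ring, show l + 2 - 1 = l + 1 by ring,
      show l - 2 + 1 = l - 1 by ring, show l - 2 - 1 = l - 3 by ring,
      show l + 1 + 2 = l + 3 by ring, show l + 1 - 2 = l - 1 by ring,
      show l - 1 + 2 = l + 1 by ring, show l - 1 - 2 = l - 3 by ring]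
    module
  have e1 := key (l + 1)
  have e0 := key l
  rw [show l + 1 + 2 = l + 3 by ring, show l + 1 - 2 = l - 1 by ring,
    show l + 1 + 1 = l + 2 by ring, show l + 1 - 1 = l by ring] at e1
  have c1 : c (l + 3) = c l := h1.eq_of_modEq ⟨1, by ring⟩
  have c2 : c (l + 2) = c (l - 1) := h1.eq_of_modEq ⟨1, by ring⟩
  have c3 : c (l - 2) = c (l + 1) := h1.eq_of_modEq ⟨-1, by ring⟩
  have d2 : d (l + 2) = d (l - 1) := h2.eq_of_modEq ⟨1, by ring⟩
  have c5 := h1.five_smul l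
  have d5 := h2.five_smul l
  apply smul_right_injective V h4
  change (4 : F) • _ = (4 : F) • _
  rw [e1, e0, c1, c2, c3, d2]
  linear_combination (norm := module) d5 - c5

theorem lam_eq_one_of_regular (H : IsUnitChain a lam) {n : ℤ} (hn : 3 ≤ n)
    (ih : ∀ m, |m| < n → Regular a lam m) (l : ℤ) : lam l (a (l + n)) = 1 := by
  have h2 := H.two_ne
  have h4 := H.four_ne
  have hr : ∀ m, -n < m → m < n → Regular a lam m := fun m h h' => ih m (abs_lt.2 ⟨h, h'⟩)
  obtain ⟨ε, hε⟩ : ∃ ε : ℤ → F, ∀ l, ε l = lam l (a (l + n)) - 1 := ⟨_, fun _ => rfl⟩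
  have t1 := H.second_difference_tri (n := n) (j := 1) (k := n - 1) (by ring)
    (hr _ (by omega) (by omega)) (hr _ (by omega) (by omega)) (hr _ (by omega) (by omega))
  have t2 := H.second_difference_tri (n := n) (j := 2) (k := n - 2) (by ring)
    (hr _ (by omega) (by omega)) (hr _ (by omega) (by omega)) (hr _ (by omega) (by omega))
  simp only [← hε] at t1 t2
  have hD := IsTriperiodic.fourth_difference_eq (x := fun l => chainS F a l n)
    (b := fun l => ε l • a l) h4 t1 t2
  have hε2 : ∀ l, ε (l + 2) = ε l := fun l => by rw [hε, hε, H.lam_add_two_index]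
  have hε2' : ∀ l, ε (l - 2) = ε l := fun l => by
    rw [← hε2 (l - 2), sub_add_cancel]
  have hε1 : ∀ l, ε (l - 1) = ε (l + 1) := fun l => by
    rw [← hε2 (l - 1), show l - 1 + 2 = l + 1 by ring]
  have hε3 : ∀ l, ε (l + 3) = ε (l + 1) := fun l => by
    rw [← hε2 (l + 1), show l + 1 + 2 = l + 3 by ring]
  have hl : ∀ l m, -n < m → m < n → lam l (a (l + m)) = 1 := fun l m h h' => (hr m h h').lam_eq l
  have hl1 : ∀ l, lam l (a (l - 1)) = 1 := fun l => by rw [H.lam_sub, H.lam_add_one]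
  have hl2 : ∀ l, lam l (a (l - 2)) = 1 := fun l => by rw [H.lam_sub, H.lam_add_two]
  have base : ∀ l, 4 * (ε (l + 1) - ε l) + ε (l + 1) * (lam l (a (l + 3)) - 1) = 0 := by
    intro l
    have := congrArg (lam l) (hD l)
    simp only [map_add, map_sub, map_smul, smul_eq_mul, hε2, hε2', hε1, hε3, H.lam_self,
      H.lam_add_one, H.lam_add_two, hl1, hl2] at this
    linear_combination this
  have hsq : ε l * ε l = 0 := by
    rcases hn.eq_or_lt with rfl | hn
    · have b0 := base l
      have b1 := base (l + 1)
      rw [show l + 1 + 1 = l + 2 by ring, hε2, ← hε] at b1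
      rw [← hε] at b0
      have hp : ε l * ε (l + 1) = 0 := by
        have : 2 * (ε l * ε (l + 1)) = 0 := by linear_combination b0 + b1
        exact (mul_eq_zero.1 this).resolve_left h2
      have he : ε (l + 1) - ε l = 0 := by
        have : 4 * (ε (l + 1) - ε l) = 0 := by linear_combination b0 - hp
        exact (mul_eq_zero.1 this).resolve_left h4
      linear_combination hp - ε l * he
    · have hc : ∀ l, ε (l + 1) = ε l := by
        intro l
        have b0 := base l
        rw [hl l 3 (by omega) (by omega), sub_self, mul_zero, add_zero] at b0
        exact sub_eq_zero.1 ((mul_eq_zero.1 b0).resolve_left h4)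
      have hc' : ∀ m, ε m = ε l := by
        intro m
        have hp : Function.Periodic ε 1 := hc
        have := hp.int_mul (m - l) l
        rwa [Int.cast_id, mul_one, add_sub_cancel] at this
      have := congrArg (lam l) (hD (l + (n - 3)))
      simp only [map_add, map_sub, map_smul, smul_eq_mul, hc'] at this
      rw [show l + (n - 3) + 3 = l + n by ring, show l + (n - 3) - 1 = l + (n - 4) by ring,
        show l + (n - 3) + 2 = l + (n - 1) by ring, show l + (n - 3) - 2 = l + (n - 5) by ring,
        show l + (n - 3) + 1 = l + (n - 2) by ring, hl l (n - 4) (by omega) (by omega),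
        hl l (n - 1) (by omega) (by omega), hl l (n - 5) (by omega) (by omega),
        hl l (n - 2) (by omega) (by omega), hl l (n - 3) (by omega) (by omega)] at this
      rw [hε] at this ⊢
      linear_combination this
  have := mul_self_eq_zero.1 hsq
  rw [hε] at this
  exact sub_eq_zero.1 this

/-- Second differences at step one are constant once the projections are known. -/
theorem second_difference_const (H : IsUnitChain a lam) {n : ℤ} (hn : 2 ≤ n)
    (ih : ∀ m, |m| < n → Regular a lam m) (hlam : ∀ l, lam l (a (l + n)) = 1) (l : ℤ) :
    chainS F a (l + 2) n + chainS F a l n - (4 : F) • chainS F a (l + 1) n =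
      chainS F a (l + 1) n + chainS F a (l - 1) n - (4 : F) • chainS F a l n := by
  have hr : ∀ m, -n < m → m < n → Regular a lam m := fun m h h' => ih m (abs_lt.2 ⟨h, h'⟩)
  have r1 := hr 1 (by omega) (by omega)
  have r2 := hr (n - 1) (by omega) (by omega)
  have r3 := hr (n - 1 - 1) (by omega) (by omega)
  have ht := H.second_difference_tri (n := n) (by ring) r1 r2 r3
  have he := H.second_difference_eq (n := n) (by ring) r1 r2 r3
  simp only [hlam, sub_self, zero_smul, smul_zero, add_zero] at ht he
  by_cases h : (5 : F) ≠ 0 ∨ ¬ (3 : ℤ) ∣ n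
  · have hp : Function.Periodic (fun l => chainS F a (l + 1) n + chainS F a (l - 1) n
        - (4 : F) • chainS F a l n) n := by
      intro l
      simp only [add_right_comm l n 1, show l + n - 1 = l - 1 + n by ring, H.chainS_add_self]
    have := ht.eq_of_periodic hp h (l + 1) l
    simpa only [add_assoc, one_add_one_eq_two, add_sub_cancel_right] using this
  · push Not at h
    have k1 := r1.chainS_eq H (Or.inr (by omega))
    have k2 := r2.chainS_eq H (Or.inr (by omega))
    have k3 := r3.chainS_eq H (Or.inr (by omega))
    have := (he (l + 1)).trans (b := _) ((by
      rw [k1 (l + 1) l, k2 (l + 1) l, k3 (l + 1) l, k3 (l + 1 + 1) l, k3 (l + 1 + -1) l,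
        k3 (l + -1) l]) : _ = _) |>.trans (he l).symm
    simpa only [add_assoc, one_add_one_eq_two, add_sub_cancel_right] using this

theorem regular_of_tri (H : IsUnitChain a lam) {n : ℤ} (hn : 2 ≤ n)
    (ih : ∀ m, |m| < n → Regular a lam m) (hlam : ∀ l, lam l (a (l + n)) = 1)
    (ht : IsTriperiodic F fun l => chainS F a l n) : Regular a lam n := by
  refine ⟨hlam, ht, fun l j => ?_⟩
  have h2 := H.two_ne
  have h4 := H.four_ne
  have h8 := H.eight_ne
  have hr : ∀ m, -n < m → m < n → Regular a lam m := fun m h h' => ih m (abs_lt.2 ⟨h, h'⟩)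
  have e1 := (H.mul_of_regular (hr 1 (by omega) (by omega)) (hr (n - 1) (by omega) (by omega))
    (hr (n - 1 - 1) (by omega) (by omega)) l).1
  rw [add_sub_cancel, hlam, sub_self, mul_zero, add_zero] at e1
  have hj : j % 3 = 0 ∨ j % 3 = 1 ∨ j % 3 = 2 := by omega
  rcases hj with hj | hj | hj
  · have k1 : chainS F a (l + j) n = chainS F a l n := ht.eq_of_modEq (by omega)
    have k2 : chainS F a (l - j) n = chainS F a l n := ht.eq_of_modEq (by omega)
    rw [k1, k2, mul_add, H.mul_chainS_self l n (hlam l)]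
    match_scalars <;> field_simp <;> ring
  · have k1 : chainS F a (l + j) n = chainS F a (l + 1) n := ht.eq_of_modEq (by omega)
    have k2 : chainS F a (l - j) n = chainS F a (l - 1) n := ht.eq_of_modEq (by omega)
    rw [k1, k2, e1]
  · have k1 : chainS F a (l + j) n = chainS F a (l - 1) n := ht.eq_of_modEq (by omega)
    have k2 : chainS F a (l - j) n = chainS F a (l + 1) n := ht.eq_of_modEq (by omega)
    rw [k1, k2, add_comm (chainS F a (l - 1) n), e1]

theorem chainS_zero (H : IsUnitChain a lam) (l : ℤ) : chainS F a l 0 = 0 := by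
  have h2 := H.two_ne
  rw [chainS, add_zero, (H.axis l).idem]
  match_scalars
  field_simp
  ring

theorem regular_zero (H : IsUnitChain a lam) : Regular a lam 0 := by
  have h2 := H.two_ne
  have h4 := H.four_ne
  have hs := H.chainS_zero
  refine ⟨fun l => by rw [add_zero, H.lam_self], ?_, fun l j => ?_⟩
  · simp only [hs]
    exact ⟨fun _ => rfl, fun _ => rfl⟩
  · rw [hs, hs, hs, add_zero, sub_zero, add_zero, mul_zero]
    match_scalars
    field_simp
    ring

theorem regular_one (H : IsUnitChain a lam) : Regular a lam 1 := by
  have h2 := H.two_ne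
  have h4 := H.four_ne
  have h8 := H.eight_ne
  have hs : ∀ r t, chainS F a r 1 = chainS F a t 1 := by
    intro r t
    have := (H.periodic_chainS 1).int_mul (r - t) t
    rwa [Int.cast_id, mul_one, add_sub_cancel] at this
  refine ⟨H.lam_add_one, ⟨fun l => hs _ _, fun l => by rw [hs (l + 1) l]⟩, fun l j => ?_⟩
  rw [hs (l + j) l, hs (l - j) l, mul_add, H.mul_chainS_self l 1 (H.lam_add_one l)]
  match_scalars <;> field_simp <;> ring

theorem regular_two (H : IsUnitChain a lam) (ih : ∀ m, |m| < 2 → Regular a lam m) :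
    Regular a lam 2 := by
  refine H.regular_of_tri le_rfl ih H.lam_add_two ?_
  have h6 : (6 : F) ≠ 0 := by
    rw [show (6 : F) = 2 * 3 by norm_num]; exact mul_ne_zero H.two_ne H.three_ne
  have hs : ∀ l, chainS F a (l + 1) 2 = chainS F a l 2 := by
    intro l
    have h := H.second_difference_const le_rfl ih H.lam_add_two l
    have p := H.chainS_add_self (l - 1) 2
    rw [show l - 1 + 2 = l + 1 by ring] at p
    rw [H.chainS_add_self, ← p] at h
    apply smul_right_injective V h6
    change (6 : F) • _ = (6 : F) • _
    linear_combination (norm := module) -h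
  refine ⟨fun l => ?_, fun l => by rw [hs]⟩
  rw [show l + 3 = l + 1 + 2 by ring, H.chainS_add_self, hs]

theorem regular_of_three_le (H : IsUnitChain a lam) {n : ℤ} (hn : 3 ≤ n)
    (ih : ∀ m, |m| < n → Regular a lam m) : Regular a lam n := by
  have hlam := H.lam_eq_one_of_regular hn ih
  refine H.regular_of_tri (by omega) ih hlam ?_
  have hc := H.second_difference_const (by omega) ih hlam
  by_cases h5 : (5 : F) = 0
  · refine ⟨fun l => ?_, fun l => by rw [h5, zero_smul, zero_smul]⟩
    have e := hc (l + 1)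
    rw [show l + 1 + 2 = l + 3 by ring, show l + 1 + 1 = l + 2 by ring,
      show l + 1 - 1 = l by ring] at e
    have z : ∀ x : V, (5 : F) • x = 0 := fun x => by rw [h5, zero_smul]
    change chainS F a (l + 3) n = chainS F a l n
    linear_combination (norm := module) e + z (chainS F a (l + 2) n) - z (chainS F a (l + 1) n)
  · have hr : ∀ m, -n < m → m < n → Regular a lam m := fun m h h' => ih m (abs_lt.2 ⟨h, h'⟩)
    have t2 := H.second_difference_tri (n := n) (j := 2) (k := n - 2) (by ring)
      (hr _ (by omega) (by omega)) (hr _ (by omega) (by omega)) (hr _ (by omega) (by omega))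
    simp only [hlam, sub_self, zero_smul, smul_zero, add_zero] at t2
    have h10 : (10 : F) ≠ 0 := by
      rw [show (10 : F) = 2 * 5 by norm_num]; exact mul_ne_zero H.two_ne h5
    have hs : ∀ l, chainS F a (l + 1) n = chainS F a l n := by
      intro l
      have e0 := hc l
      have e1 := hc (l + 1)
      have e2 := hc (l - 1)
      have e3 := t2.eq_of_ne h5 (l + 1) l
      simp only [show l + 1 + 2 = l + 3 by ring, show l + 1 - 2 = l - 1 by ring,
        show l + 1 + 1 = l + 2 by ring, show l + 1 - 1 = l by ring,
        show l - 1 + 2 = l + 1 by ring, show l - 1 - 1 = l - 2 by ring,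
        show l - 1 + 1 = l by ring] at e0 e1 e2 e3
      apply smul_right_injective V h10
      change (10 : F) • _ = (10 : F) • _
      linear_combination (norm := module) e3 - e1 - e2 - (4 : F) • e0
    refine ⟨fun l => ?_, fun l => by rw [hs]⟩
    rw [show l + 3 = l + 1 + 1 + 1 by ring, hs, hs, hs]

theorem regular (H : IsUnitChain a lam) (n : ℤ) : Regular a lam n := by
  have main : ∀ n : ℕ, Regular a lam n := by
    intro n
    induction n using Nat.strong_induction_on with
    | _ n ih =>
      have ih' : ∀ m : ℤ, |m| < n → Regular a lam m := by
        intro m hm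
        have := ih m.natAbs (by rw [abs_lt] at hm; omega)
        rcases Int.natAbs_eq m with h | h
        · rwa [← h] at this
        · rw [h]
          exact this.neg H
      match n, ih' with
      | 0, _ => exact H.regular_zero
      | 1, _ => exact H.regular_one
      | 2, ih' => exact H.regular_two ih'
      | n + 3, ih' => exact H.regular_of_three_le (by push_cast; omega) ih'
  rcases Int.natAbs_eq n with h | h <;> rw [h]
  · exact main _
  · exact (main _).neg H

end IsUnitChain

namespace AxisChain

variable {a : ℤ → V} {α β : F}

theorem reflect_proj (h : AxisChain F α β a) {l m : ℤ} {c : F} (hp : HasProj F α β (a l) (a m) c)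
    (k : ℤ) : HasProj F α β (a (2 * k - l)) (a (2 * k - m)) c := by
  obtain ⟨τ, hm, ha, -⟩ := h.reflection k
  have := hp.map τ hm
  rwa [ha, ha] at this

theorem forall_of_reflect {P : ℤ → Prop} (h0 : P 0) (h1 : P 1)
    (hP : ∀ l k, P l → P (2 * k - l)) (l : ℤ) : P l := by
  obtain ⟨m, rfl | rfl⟩ := Int.even_or_odd' l
  · simpa using hP 0 m h0
  · have := hP 1 (m + 1) h1
    rwa [show 2 * (m + 1) - 1 = 2 * m + 1 by ring] at this

theorem proj_add (h : AxisChain F α β a) {n : ℤ} {c : F} (h0 : HasProj F α β (a 0) (a n) c)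
    (h1 : HasProj F α β (a 1) (a (1 - n)) c) (l : ℤ) : HasProj F α β (a l) (a (l + n)) c := by
  have refl : ∀ {l m}, HasProj F α β (a l) (a m) c → HasProj F α β (a l) (a (2 * l - m)) c := by
    intro l m hp
    have := h.reflect_proj hp l
    rwa [show 2 * l - l = l by ring] at this
  refine forall_of_reflect (P := fun l => HasProj F α β (a l) (a (l + n)) c) ?_ ?_ ?_ l
  · rwa [zero_add]
  · have := refl h1
    rwa [show 2 * (1 : ℤ) - (1 - n) = 1 + n by ring] at this
  · intro l k hp
    have := refl (h.reflect_proj hp k)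
    rwa [show 2 * (2 * k - l) - (2 * k - (l + n)) = 2 * k - l + n by ring] at this

theorem eq_zero (h : AxisChain F α β a) (h0 : a 0 = 0) (h1 : a 1 = 0) (l : ℤ) : a l = 0 := by
  refine forall_of_reflect (P := fun l => a l = 0) h0 h1 (fun l k hl => ?_) l
  obtain ⟨τ, -, ha, -⟩ := h.reflection k
  rw [← ha, hl, map_zero]

theorem ne_zero (h : AxisChain F α β a) (h0 : a 0 ≠ 0) (h1 : a 1 ≠ 0) (l : ℤ) : a l ≠ 0 := by
  refine forall_of_reflect (P := fun l => a l ≠ 0) h0 h1 (fun l k hl => ?_) l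
  obtain ⟨τ, -, ha, -⟩ := h.reflection k
  rw [← ha]
  exact fun h => hl (τ.map_eq_zero_iff.1 h)

theorem exists_isUnitChain {a : ℤ → V} (h : AxisChain F 2 (1 / 2) a) (h2 : (2 : F) ≠ 0)
    (h3 : (3 : F) ≠ 0) (hl1 : HasProj F 2 (1 / 2) (a 0) (a 1) 1)
    (hl1f : HasProj F 2 (1 / 2) (a 1) (a 0) 1) (hl2 : HasProj F 2 (1 / 2) (a 0) (a 2) 1)
    (hl2f : HasProj F 2 (1 / 2) (a 1) (a (-1)) 1) :
    (∀ l, a l = 0) ∨ ∃ lam : ℤ → V →ₗ[F] F, IsUnitChain a lam := by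
  have key : ∀ {e : V}, IsAxis F 2 (1 / 2) e → HasProj F 2 (1 / 2) e 0 1 → e = 0 := by
    intro e he hp
    by_contra hne
    obtain ⟨f, hf1, hf⟩ := he.exists_linearMap h2 hne
    rw [he.hasProj_iff hf1 hf, map_zero] at hp
    exact zero_ne_one hp
  by_cases h0 : a 0 = 0
  · rw [h0] at hl1f
    exact Or.inl (h.eq_zero h0 (key (h.axis 1) hl1f))
  by_cases h1 : a 1 = 0
  · rw [h1] at hl1
    exact Or.inl (h.eq_zero (key (h.axis 0) hl1) h1)
  choose lam hlam1 hlam using fun l => (h.axis l).exists_linearMap h2 (h.ne_zero h0 h1 l)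
  refine Or.inr ⟨lam, h, h2, h3, hlam1, hlam, fun l => ?_, fun l => ?_⟩
  · exact ((h.axis l).hasProj_iff (hlam1 l) (hlam l)).1 (h.proj_add hl1 (by simpa using hl1f) l)
  · exact ((h.axis l).hasProj_iff (hlam1 l) (hlam l)).1 (h.proj_add hl2 (by simpa using hl2f) l)

end AxisChain

namespace IsUnitChain

variable {a : ℤ → V} {lam : ℤ → V →ₗ[F] F}

theorem hasProj_chainS (H : IsUnitChain a lam) (l r n : ℤ) :
    HasProj F 2 (1 / 2) (a l) (chainS F a r n) 0 := by
  have h2 := H.two_ne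
  have h4 := H.four_ne
  have h8 := H.eight_ne
  rw [(H.axis l).hasProj_iff (H.lam_self l) (H.lam_mul l)]
  have h := congrArg (lam l) ((H.regular n).mul_chainS H l r)
  have hd := H.lam_eq_zero l (H.chainS_sub_mem l (r - l) n)
  rw [show l + (r - l) = r by ring, show l - (r - l) = 2 * l - r by ring] at hd
  rw [H.lam_mul] at h
  simp only [map_add, map_sub (lam l) _ ((3 / 4 : F) • a l), map_smul, hd, H.lam_chainS,
    H.lam_sub, (H.regular n).lam_eq, H.lam_self, smul_eq_mul] at h
  rw [h]
  field_simp
  ring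

theorem mul_chainS_eq (H : IsUnitChain a lam) (l r i : ℤ) : a l * chainS F a r i =
    -((3 : F) / 4) • a l + ((3 : F) / 8) • (a (l - i) + a (l + i))
      + ((3 : F) / 2) • chainS F a r i
      + charDelta F (l - r) • (chainS F a (r - 1) i - chainS F a (r + 1) i) := by
  have h2 := H.two_ne
  have h4 := H.four_ne
  have hi := H.regular i
  rw [hi.mul_chainS H l r, charDelta]
  split_ifs with h5 m0 m1
  · have k1 : chainS F a l i = chainS F a r i := hi.tri.eq_of_modEq (by omega)
    have k2 : chainS F a (2 * l - r) i = chainS F a r i := hi.tri.eq_of_modEq (by omega)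
    rw [k1, k2]
    module
  · have k1 : chainS F a l i = chainS F a (r + 1) i := hi.tri.eq_of_modEq (by omega)
    have k2 : chainS F a (2 * l - r) i = chainS F a (r - 1) i := hi.tri.eq_of_modEq (by omega)
    have z : ∀ x : V, (5 : F) • x = 0 := fun x => by rw [h5, zero_smul]
    rw [k1, k2]
    linear_combination (norm := skip) (1 / 2 : F) • z (chainS F a (r + 1) i)
      - (1 / 4 : F) • z (chainS F a r i) - (1 / 4 : F) • z (chainS F a (r - 1) i)
    match_scalars <;> field_simp <;> ring
  · have k1 : chainS F a l i = chainS F a (r - 1) i := hi.tri.eq_of_modEq (by omega)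
    have k2 : chainS F a (2 * l - r) i = chainS F a (r + 1) i := hi.tri.eq_of_modEq (by omega)
    have z : ∀ x : V, (5 : F) • x = 0 := fun x => by rw [h5, zero_smul]
    rw [k1, k2]
    linear_combination (norm := skip) (1 / 2 : F) • z (chainS F a (r - 1) i)
      - (1 / 4 : F) • z (chainS F a r i) - (1 / 4 : F) • z (chainS F a (r + 1) i)
    match_scalars <;> field_simp <;> ring
  · rw [hi.tri.eq_of_ne h5 l r, hi.tri.eq_of_ne h5 (2 * l - r) r]
    module

theorem chainS_mul_chainS (H : IsUnitChain a lam) (i j r : ℤ) :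
    chainS F a r j * chainS F a r (i - j) =
      ((3 : F) / 4) • (chainS F a r j + chainS F a r (i - j))
        - ((3 : F) / 4) • chainS F a r |i - 2 * j|
        + ((3 : F) / 16) • (chainS F a (r + j) |i - 2 * j| + chainS F a (r - j) |i - 2 * j|)
        - ((3 : F) / 4) • chainS F a r i
        + ((3 : F) / 16) • (chainS F a (r + j) i + chainS F a (r - j) i) := by
  have h := (H.mul_of_regular (H.regular j) (H.regular (i - j)) (H.regular _) r).2
  rw [add_sub_cancel, (H.regular i).lam_eq, show i - j - j = i - 2 * j by ring] at h
  simp only [H.chainS_abs]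
  rw [h]
  module

theorem chainS_mul_chainS_of_not_dvd (H : IsUnitChain a lam) {i j : ℤ}
    (hij : (5 : F) ≠ 0 ∨ ¬ (3 : ℤ) ∣ i - 2 * j ∨ (i = 2 * j ∧ ¬ (3 : ℤ) ∣ j)) (r : ℤ) :
    chainS F a r j * chainS F a r (i - j) =
      ((3 : F) / 4) • (chainS F a r j + chainS F a r (i - j))
        - ((3 : F) / 8) • chainS F a r |i - 2 * j|
        - ((3 : F) / 4) • chainS F a r i
        + ((3 : F) / 16) • (chainS F a (r + 1) i + chainS F a (r + 2) i) := by
  have h2 := H.two_ne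
  have h4 := H.four_ne
  have h8 := H.eight_ne
  have h16 := H.sixteen_ne
  have hi := H.regular i
  have hm : ∀ t, chainS F a t (i - 2 * j) = chainS F a r (i - 2 * j) := by
    intro t
    rcases hij with h | h | ⟨rfl, -⟩
    · exact (H.regular _).chainS_eq H (Or.inl h) t r
    · exact (H.regular _).chainS_eq H (Or.inr h) t r
    · rw [sub_self, H.chainS_zero, H.chainS_zero]
  have hS : chainS F a (r + j) i + chainS F a (r - j) i =
      chainS F a (r + 1) i + chainS F a (r + 2) i := by
    by_cases h : (5 : F) ≠ 0 ∨ ¬ (3 : ℤ) ∣ i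
    · have := hi.chainS_eq H h
      rw [this (r + j) r, this (r - j) r, this (r + 1) r, this (r + 2) r]
    · push Not at h
      have hj : j % 3 = 1 ∨ j % 3 = 2 := by
        rcases hij with h' | h' | h'
        · exact absurd h.1 h'
        · omega
        · omega
      rcases hj with hj | hj
      · have k1 : chainS F a (r + j) i = chainS F a (r + 1) i := hi.tri.eq_of_modEq (by omega)
        have k2 : chainS F a (r - j) i = chainS F a (r + 2) i := hi.tri.eq_of_modEq (by omega)
        rw [k1, k2]
      · have k1 : chainS F a (r + j) i = chainS F a (r + 2) i := hi.tri.eq_of_modEq (by omega)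
        have k2 : chainS F a (r - j) i = chainS F a (r + 1) i := hi.tri.eq_of_modEq (by omega)
        rw [k1, k2, add_comm]
  rw [H.chainS_mul_chainS, hS]
  simp only [H.chainS_abs]
  rw [hm (r + j), hm (r - j)]
  match_scalars <;> field_simp <;> ring

end IsUnitChain

end

end AxialFormal

theorem exclaim {F : Type*} [Field F] {V : Type*} [NonUnitalNonAssocCommRing V]
    [Module F V] [SMulCommClass F V V] [IsScalarTower F V V]
    (hchar2 : (2 : F) ≠ 0) (hchar3 : (3 : F) ≠ 0)
    {α β : F} (hα : α = 2) (hβ : β = 1 / 2)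
    {a₀ a₁ : V} (hV : AxialFormal.IsTwoGenerated F α β a₀ a₁)
    (a : ℤ → V) (ha : a = AxialFormal.axSeq F α β a₀ a₁)
    (s : ℤ → ℤ → V) (hs : s = AxialFormal.sElt F α β a₀ a₁)
    (hl1 : AxialFormal.HasProj F α β a₀ (a 1) 1)
    (hl1f : AxialFormal.HasProj F α β a₁ (a 0) 1)
    (hl2 : AxialFormal.HasProj F α β a₀ (a 2) 1)
    (hl2f : AxialFormal.HasProj F α β a₁ (a (-1)) 1) :
    ∀ i : ℤ, 1 ≤ i →
      -- (1)
      (AxialFormal.HasProj F α β a₀ (a i) 1 ∧ AxialFormal.HasProj F α β a₁ (a (1 - i)) 1) ∧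
      -- (2)
      (∀ r : ℤ, ((5 : F) ≠ 0 ∨ ¬ (3 : ℤ) ∣ i) → s r i = s 0 i) ∧
      -- (3)
      (∀ r t : ℤ, (5 : F) = 0 → (3 : ℤ) ∣ i → t ≡ r [ZMOD 3] → s r i = s t i) ∧
      -- (4)
      (∀ r : ℤ, AxialFormal.HasProj F α β a₀ (s r i) 0) ∧
      -- (5)
      (∀ l r : ℤ, a l * s r i =
        -((3 : F) / 4) • a l + ((3 : F) / 8) • (a (l - i) + a (l + i))
          + ((3 : F) / 2) • s r i
          + AxialFormal.charDelta F (l - r) • (s (r - 1) i - s (r + 1) i)) ∧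
      -- (6), in every characteristic
      (∀ j : ℤ, 1 ≤ j → j < i → ∀ r : ℤ,
        s r j * s r (i - j) =
          ((3 : F) / 4) • (s r j + s r (i - j))
            - ((3 : F) / 4) • s r |i - 2 * j|
            + ((3 : F) / 16) • (s (r + j) |i - 2 * j| + s (r - j) |i - 2 * j|)
            - ((3 : F) / 4) • s r i
            + ((3 : F) / 16) • (s (r + j) i + s (r - j) i)) ∧
      -- (6), in simplified form
      (∀ j : ℤ, 1 ≤ j → j < i →
        ((5 : F) ≠ 0 ∨ ¬ (3 : ℤ) ∣ i - 2 * j ∨ (i = 2 * j ∧ ¬ (3 : ℤ) ∣ j)) → ∀ r : ℤ,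
        s r j * s r (i - j) =
          ((3 : F) / 4) • (s r j + s r (i - j)) - ((3 : F) / 8) • s r |i - 2 * j|
            - ((3 : F) / 4) • s r i
            + ((3 : F) / 16) • (s (r + 1) i + s (r + 2) i)) := by
  subst hα hβ
  have hb0 : (1 / 2 : F) ≠ 0 := one_div_ne_zero hchar2
  have hb2 : (1 / 2 : F) ≠ 2 := by
    intro h
    field_simp at h
    exact hchar3 (by linear_combination -h)
  have hchain := hV.axisChain hb0 AxialFormal.half_ne_one hb2
  rw [← ha] at hchain
  have h0 : a 0 = a₀ := by
    rw [ha]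
    exact AxialFormal.axSeq_two_mul 2 (1 / 2) a₀ a₁ 0
  have h1 : a 1 = a₁ := by
    rw [ha]
    exact AxialFormal.axSeq_two_mul_add_one 2 (1 / 2) a₀ a₁ 0
  have hs : s = AxialFormal.chainS F a := by
    rw [hs, ha]
    rfl
  clear ha
  subst hs h0 h1
  rcases hchain.exists_isUnitChain hchar2 hchar3 hl1 hl1f hl2 hl2f with hz | ⟨lam, H⟩
  · have hsz : ∀ r n, AxialFormal.chainS F a r n = 0 := fun r n => by
      simp [AxialFormal.chainS, hz]
    have hpz : ∀ b c : F, AxialFormal.HasProj F 2 b (0 : V) 0 c := fun b c =>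
      ⟨0, Submodule.zero_mem _, 0, Submodule.zero_mem _, 0, Submodule.zero_mem _, by simp⟩
    simp [hsz, hz, hpz]
  · intro i _
    have hi := H.regular i
    have hp : ∀ l m, AxialFormal.HasProj F 2 (1 / 2) (a l) (a (l + m)) 1 := fun l m =>
      ((H.axis l).hasProj_iff (H.lam_self l) (H.lam_mul l)).2 ((H.regular m).lam_eq l)
    refine ⟨⟨?_, ?_⟩, ?_, ?_, ?_, ?_, ?_, ?_⟩
    · simpa using hp 0 i
    · simpa [sub_eq_add_neg] using hp 1 (-i)
    · exact fun r h => hi.chainS_eq H h r 0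
    · exact fun r t _ _ h => hi.tri.eq_of_modEq h.dvd
    · exact fun r => H.hasProj_chainS 0 r i
    · exact fun l r => H.mul_chainS_eq l r i
    · exact fun j _ _ r => H.chainS_mul_chainS i j r
    · exact fun j _ _ h r => H.chainS_mul_chainS_of_not_dvd h r
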